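/- arXiv:1703.01917 — 6 statements merged into one kernel-verified Lean document; each statement's English description precedes it below -/
import Mathlib

section
/- Let D be a p-subgroup of the finite group G with |D| = p^d, and let e be a central idempotent of FG with e ∈ I_{≤D}(G). Then e · J(Z(FG))^{(p^{d+1}−1)/(p−1)} = 0; in particular, the Loewy length of the direct factor Z(FG)·e of Z(FG) is at most (p^{d+1}−1)/(p−1). -/
set_option synthInstance.maxHeartbeats 1000000
set_option maxHeartbeats 1000000

open scoped Classical

/-- The class sum `K⁺ = ∑_{x ∈ K} x` of a conjugacy class `K` in the group algebra `FG`. -/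
noncomputable def classSum (F : Type) [Field F] {G : Type} [Group G] [Fintype G]
    (K : ConjClasses G) : MonoidAlgebra F G :=
  ∑ x : G, if x ∈ K.carrier then MonoidAlgebra.single x (1 : F) else 0

/-- `P` is a defect group of the conjugacy class `K`: `P` is a Sylow `p`-subgroup of the
centralizer of some element of `K`. -/
def IsClassDefectGroup {G : Type} [Group G] (p : ℕ) (P : Subgroup G) (K : ConjClasses G) : Prop :=
  ∃ x ∈ K.carrier, ∃ S : Sylow p ↥(Subgroup.centralizer {x}),
    P = Subgroup.map (Subgroup.centralizer {x}).subtype S.toSubgroup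

/-- `I_P(G)`: the `F`-span of the class sums of conjugacy classes with defect group `P`. -/
noncomputable def classIdeal (F : Type) [Field F] {G : Type} [Group G] [Fintype G]
    (p : ℕ) (P : Subgroup G) : Submodule F (MonoidAlgebra F G) :=
  Submodule.span F {a | ∃ K : ConjClasses G, IsClassDefectGroup p P K ∧ a = classSum F K}

/-- `I_{≤P}(G) = ∑_{Q ≤ P} I_Q(G)`. -/
noncomputable def classIdealLE (F : Type) [Field F] {G : Type} [Group G] [Fintype G]
    (p : ℕ) (P : Subgroup G) : Submodule F (MonoidAlgebra F G) :=
  ⨆ Q ≤ P, classIdeal F p Q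

/-- `I_{<P}(G) = ∑_{Q < P} I_Q(G)`. -/
noncomputable def classIdealLT (F : Type) [Field F] {G : Type} [Group G] [Fintype G]
    (p : ℕ) (P : Subgroup G) : Submodule F (MonoidAlgebra F G) :=
  ⨆ Q < P, classIdeal F p Q

/-- The Jacobson radical `J(Z(FG))` of the center of the group algebra, viewed as an
`F`-submodule of `FG`. -/
noncomputable def JZ (F : Type) [Field F] (G : Type) [Group G] [Fintype G] :
    Submodule F (MonoidAlgebra F G) :=
  Submodule.map (Subalgebra.center F (MonoidAlgebra F G)).val.toLinearMap
    ((Ideal.jacobson (⊥ : Ideal ↥(Subalgebra.center F (MonoidAlgebra F G)))).restrictScalars F)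

open MonoidAlgebra

/-! ### Coefficients in the group algebra -/

theorem coeff_mul_eq_sum {F G : Type*} [Semiring F] [Group G] [Fintype G]
    (x y : MonoidAlgebra F G) (t : G) :
    (x * y).coeff t = ∑ g, x.coeff g * y.coeff (g⁻¹ * t) := by
  rw [coeff_mul_apply_left, Finsupp.sum_fintype]
  simp

theorem mem_center_iff_commute_single {F G : Type*} [Field F] [Group G]
    {x : MonoidAlgebra F G} :
    x ∈ Subalgebra.center F (MonoidAlgebra F G) ↔ ∀ g : G, single g 1 * x = x * single g 1 := by
  rw [Subalgebra.mem_center_iff]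
  refine ⟨fun h g => h _, fun h b => ?_⟩
  induction b using MonoidAlgebra.induction_on with
  | of g => exact h g
  | add a b ha hb => rw [add_mul, mul_add, ha, hb]
  | smul r a ha => rw [smul_mul_assoc, mul_smul_comm, ha]

theorem mem_center_iff_coeff_conj {F G : Type*} [Field F] [Group G] {x : MonoidAlgebra F G} :
    x ∈ Subalgebra.center F (MonoidAlgebra F G) ↔
      ∀ g h : G, x.coeff (g * h * g⁻¹) = x.coeff h := by
  rw [mem_center_iff_commute_single]
  refine forall_congr' fun g => ⟨fun h t => ?_, fun h => ?_⟩
  · have := congrArg (fun a => a.coeff (g * t)) h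
    simpa [coeff_single_mul_apply, coeff_mul_single_apply] using this.symm
  · ext t
    have := h (g⁻¹ * t)
    simpa [coeff_single_mul_apply, coeff_mul_single_apply] using this.symm

/-- An invariant function on a finite set acted on by a `p`-group has the same sum in
characteristic `p` as its restriction to the fixed points. -/
theorem IsPGroup.sum_eq_sum_fixedPoints {F : Type*} [CommRing F] {p : ℕ} [Fact p.Prime] [CharP F p]
    {Q X : Type*} [Group Q] [Fintype X] [MulAction Q X] (hQ : IsPGroup p Q) (f : X → F)
    (hf : ∀ (q : Q) x, f (q • x) = f x) :
    ∑ x, f x = ∑ x, if x ∈ MulAction.fixedPoints Q X then f x else 0 := by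
  have key (v : F) : ((Finset.univ.filter fun x => f x = v).card : F) =
      ((Finset.univ.filter fun x => f x = v ∧ x ∈ MulAction.fixedPoints Q X).card : F) := by
    let Y : SubMulAction Q X :=
      { carrier := {x | f x = v}
        smul_mem' := fun q x hx => by simpa [hf] using hx }
    have h1 : Nat.card Y = (Finset.univ.filter fun x => f x = v).card := by
      rw [Nat.card_eq_fintype_card, Fintype.card_subtype]; rfl
    have h2 : Nat.card (MulAction.fixedPoints Q Y) =
        (Finset.univ.filter fun x => f x = v ∧ x ∈ MulAction.fixedPoints Q X).card := by
      rw [← Fintype.card_subtype, ← Nat.card_eq_fintype_card]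
      refine Nat.card_congr
        ⟨fun y => ⟨y.1.1, y.1.2, fun q => congrArg Subtype.val (y.2 q)⟩,
         fun x => ⟨⟨x.1, x.2.1⟩, fun q => Subtype.ext (x.2.2 q)⟩, fun _ => rfl, fun _ => rfl⟩
    rw [← h1, ← h2, CharP.natCast_eq_natCast F p]
    exact hQ.card_modEq_card_fixedPoints Y
  rw [← Finset.sum_fiberwise_of_maps_to (t := Finset.univ.image f) (g := f) (by simp),
    ← Finset.sum_fiberwise_of_maps_to (t := Finset.univ.image f) (g := f) (by simp)]
  refine Finset.sum_congr rfl fun v _ => ?_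
  rw [Finset.sum_congr rfl (g := fun _ => v) (by simp), Finset.sum_const, nsmul_eq_mul, key,
    ← nsmul_eq_mul, ← Finset.sum_const, Finset.sum_ite, Finset.sum_const_zero, add_zero,
    Finset.filter_filter]
  exact Finset.sum_congr rfl fun x hx => (Finset.mem_filter.1 hx).2.1.symm

/-- Coefficients of a product of central elements at an element centralizing a `p`-subgroup only
involve elements centralizing that subgroup. -/
theorem coeff_mul_eq_sum_centralizer {F G : Type*} [Field F] [Group G] [Fintype G]
    {p : ℕ} [Fact p.Prime] [CharP F p] {x y : MonoidAlgebra F G}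
    (hx : x ∈ Subalgebra.center F (MonoidAlgebra F G))
    (hy : y ∈ Subalgebra.center F (MonoidAlgebra F G)) {Q : Subgroup G} (hQ : IsPGroup p Q)
    {t : G} (ht : t ∈ Subgroup.centralizer (Q : Set G)) :
    (x * y).coeff t =
      ∑ g, if g ∈ Subgroup.centralizer (Q : Set G) then x.coeff g * y.coeff (g⁻¹ * t) else 0 := by
  rw [mem_center_iff_coeff_conj] at hx hy
  rw [Subgroup.mem_centralizer_iff] at ht
  rw [coeff_mul_eq_sum]
  have := (hQ.map (ConjAct.toConjAct : G ≃* ConjAct G).toMonoidHom).sum_eq_sum_fixedPoints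
    (fun g : G => x.coeff g * y.coeff (g⁻¹ * t)) ?_
  · rw [this]
    refine Finset.sum_congr rfl fun g _ => if_congr ?_ rfl rfl
    rw [MulAction.mem_fixedPoints, Subgroup.mem_centralizer_iff]
    constructor
    · intro h q hq
      exact mul_inv_eq_iff_eq_mul.1 (h ⟨ConjAct.toConjAct q, q, hq, rfl⟩)
    · rintro h ⟨_, q, hq, rfl⟩
      exact mul_inv_eq_iff_eq_mul.2 (h q hq)
  · rintro ⟨_, q, hq, rfl⟩ g
    have h1 : (q * g * q⁻¹)⁻¹ * t = q * (g⁻¹ * t) * q⁻¹ := by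
      have := ht q hq
      rw [eq_mul_inv_iff_mul_eq]
      simp only [mul_inv_rev, inv_inv, mul_assoc]
      rw [← this]; simp
    change x.coeff (q * g * q⁻¹) * y.coeff ((q * g * q⁻¹)⁻¹ * t) = _
    rw [h1, hx, hy]

/-! ### Class functions supported on classes of defect zero -/

theorem sum_coeff_conj_mul_eq_zero {F H : Type*} [Field F] [Group H] [Fintype H]
    {z : MonoidAlgebra F H} (hz : z ∈ Subalgebra.center F (MonoidAlgebra F H))
    (hnil : IsNilpotent z) (a : MonoidAlgebra F H) (t : H) :
    ∑ g : H, (a * z).coeff (g⁻¹ * t * g) = 0 := by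
  let T : Module.End F (MonoidAlgebra F H) :=
    LinearMap.mulLeft F (single t⁻¹ (1 : F)) * LinearMap.mulRight F a * LinearMap.mulLeft F z
  have hT : IsNilpotent T := by
    refine Commute.isNilpotent_mul_left ?_ ((LinearMap.isNilpotent_mulLeft_iff F z).2 hnil)
    rw [Subalgebra.mem_center_iff] at hz
    refine LinearMap.ext fun x => ?_
    simp only [Module.End.mul_apply, LinearMap.mulLeft_apply, LinearMap.mulRight_apply]
    rw [← hz x, ← hz, mul_assoc, mul_assoc, ← hz a]
    simp only [mul_assoc]
  have htr := (LinearMap.isNilpotent_trace_of_isNilpotent hT).eq_zero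
  rw [LinearMap.trace_eq_matrix_trace F (MonoidAlgebra.basis H F), Matrix.trace] at htr
  rw [← htr]
  refine Finset.sum_congr rfl fun g _ => ?_
  rw [Subalgebra.mem_center_iff] at hz
  rw [Matrix.diag_apply, LinearMap.toMatrix_apply, basis_apply]
  change _ = (T (single g 1)).coeff g
  simp only [T, Module.End.mul_apply, LinearMap.mulLeft_apply, LinearMap.mulRight_apply]
  have hcomm : z * single g 1 * a = single g 1 * (a * z) := by
    rw [← hz (single g 1), mul_assoc, ← hz a]
  rw [hcomm]
  simp [coeff_single_mul_apply, mul_assoc]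

/-- A central element supported on classes whose centralizer order is invertible in `F` kills
all nilpotent central elements. -/
theorem mul_eq_zero_of_isNilpotent_of_defect_zero {F H : Type*} [Field F] [Group H] [Fintype H]
    {y z : MonoidAlgebra F H} (hy : y ∈ Subalgebra.center F (MonoidAlgebra F H))
    (hdef : ∀ h, y.coeff h ≠ 0 → (Nat.card (Subgroup.centralizer {h}) : F) ≠ 0)
    (hz : z ∈ Subalgebra.center F (MonoidAlgebra F H)) (hnil : IsNilpotent z) :
    y * z = 0 := by
  let r : H → H := fun h => (ConjClasses.mk h).out
  have hr (h : H) : IsConj h (r h) :=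
    (ConjClasses.mk_eq_mk_iff_isConj.1 (Quotient.out_eq (ConjClasses.mk h))).symm
  have hr' (g h : H) : r (g⁻¹ * h * g) = r h := by
    have : ConjClasses.mk (g⁻¹ * h * g) = ConjClasses.mk h :=
      ConjClasses.mk_eq_mk_iff_isConj.2 (isConj_iff.2 ⟨g, by group⟩)
    simp only [r, this]
  let a : MonoidAlgebra F H := ∑ x, if r x = x then
    single x (y.coeff x * (Nat.card (Subgroup.centralizer {x}) : F)⁻¹) else 0
  have ha (x : H) : a.coeff x =
      if r x = x then y.coeff x * (Nat.card (Subgroup.centralizer {x}) : F)⁻¹ else 0 := by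
    simp only [a, coeff_sum, Finsupp.finsetSum_apply]
    rw [Finset.sum_eq_single x]
    · split_ifs <;> simp
    · intro b _ hb
      split_ifs <;> simp [hb]
    · simp
  have hya (h : H) : ∑ g : H, a.coeff (g⁻¹ * h * g) = y.coeff h := by
    obtain ⟨c, hc⟩ := isConj_iff.1 (hr h)
    simp only [ha, hr']
    have hyr : y.coeff (r h) = y.coeff h := by
      rw [← hc, mem_center_iff_coeff_conj.1 hy]
    rw [Finset.sum_congr rfl (g := fun g : H => if r h = g⁻¹ * h * g then
      y.coeff h * (Nat.card (Subgroup.centralizer {r h}) : F)⁻¹ else 0)]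
    · rw [← Finset.sum_filter, Finset.sum_const, nsmul_eq_mul]
      have hcard : (Finset.univ.filter fun g => r h = g⁻¹ * h * g).card =
          Nat.card (Subgroup.centralizer {r h}) := by
        rw [← Fintype.card_subtype, ← Nat.card_eq_fintype_card]
        refine Nat.card_congr ((Equiv.mulLeft c).subtypeEquiv fun g => ?_)
        rw [Subgroup.mem_centralizer_singleton_iff, Equiv.coe_mulLeft, ← hc]
        constructor
        · intro h1
          have : c * g * (g⁻¹ * h * g) = c * h * c⁻¹ * (c * g) := by group
          rwa [← h1] at this
        · intro h1
          rw [eq_inv_mul_of_mul_eq h1]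
          group
      rw [hcard]
      by_cases h0 : y.coeff h = 0
      · simp [h0]
      · rw [← hyr] at h0 ⊢
        have := hdef _ h0
        field_simp
    · intro g _
      split_ifs with h1
      · rw [← h1, hyr]
      · rfl
  ext t
  rw [coeff_mul_eq_sum]
  simp only [← hya, Finset.sum_mul]
  rw [Finset.sum_comm, coeff_zero, Finsupp.zero_apply, ← sum_coeff_conj_mul_eq_zero hz hnil a t]
  refine Finset.sum_congr rfl fun g _ => ?_
  rw [coeff_mul_eq_sum]
  refine Fintype.sum_equiv (MulAut.conj g⁻¹).toEquiv _ _ fun h => ?_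
  change _ = a.coeff (g⁻¹ * h * g⁻¹⁻¹) * z.coeff ((g⁻¹ * h * g⁻¹⁻¹)⁻¹ * _)
  rw [inv_inv]
  congr 1
  rw [← mem_center_iff_coeff_conj.1 hz g⁻¹ (h⁻¹ * t)]
  congr 1
  group

/-! ### The augmentation ideal of a finite abelian `p`-group -/

open scoped Pointwise in
theorem Submodule.pow_finrank_eq_bot_of_commute_of_isNilpotent {F A : Type*} [Field F] [Ring A]
    [Algebra F A] [FiniteDimensional F A] (I : Submodule F A)
    (hc : ∀ a ∈ I, ∀ b ∈ I, Commute a b) (hn : ∀ a ∈ I, IsNilpotent a) :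
    I ^ Module.finrank F A = ⊥ := by
  have key (n : ℕ) : ∀ x ∈ (I : Set A) ^ n, (∀ a ∈ I, Commute a x) ∧
      (x = 0 ∨ Module.finrank F (LinearMap.range (LinearMap.mulLeft F x)) + n ≤
        Module.finrank F A) := by
    induction n with
    | zero =>
      intro x hx
      rw [pow_zero, Set.mem_one] at hx
      subst hx
      exact ⟨fun a _ => Commute.one_right a, Or.inr (Submodule.finrank_le _)⟩
    | succ n ih =>
      rintro _ hx
      rw [pow_succ'] at hx
      obtain ⟨a, ha, x, hx, rfl⟩ := hx
      obtain ⟨h1, h2⟩ := ih x hx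
      refine ⟨fun b hb => (hc b hb a ha).mul_right (h1 b hb), ?_⟩
      rcases h2 with rfl | h2
      · simp
      rw [or_iff_not_imp_left]
      intro h0
      have hle : LinearMap.range (LinearMap.mulLeft F (a * x)) ≤
          LinearMap.range (LinearMap.mulLeft F x) := by
        rintro _ ⟨b, rfl⟩
        exact ⟨a * b, by simp [← mul_assoc, (h1 a ha).eq]⟩
      have hlt : LinearMap.range (LinearMap.mulLeft F (a * x)) <
          LinearMap.range (LinearMap.mulLeft F x) := by
        refine lt_of_le_of_ne hle fun heq => h0 ?_
        have hmap (k : ℕ) : x ∈ LinearMap.range (LinearMap.mulLeft F (a ^ k * x)) := by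
          induction k with
          | zero => exact ⟨1, by simp⟩
          | succ k ihk =>
            obtain ⟨b, hb⟩ := ihk
            have hxb : x * b ∈ LinearMap.range (LinearMap.mulLeft F (a * x)) :=
              heq ▸ ⟨b, rfl⟩
            obtain ⟨b', hb'⟩ := hxb
            refine ⟨b', ?_⟩
            simp only [LinearMap.mulLeft_apply] at hb hb' ⊢
            rw [pow_succ, mul_assoc, mul_assoc, ← mul_assoc a, hb', ← mul_assoc, hb]
        obtain ⟨k, hk⟩ := hn a ha
        have := hmap k
        rw [hk, zero_mul] at this
        obtain ⟨b, hb⟩ := this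
        rw [← hb]
        simp
      have := Submodule.finrank_lt_finrank_of_lt hlt
      change Module.finrank F (LinearMap.range (LinearMap.mulLeft F (a * x))) + (n + 1) ≤ _
      omega
  rw [Submodule.pow_eq_span_pow_set, Submodule.span_eq_bot]
  intro x hx
  rcases (key _ x hx).2 with h | h
  · exact h
  · have h0 : LinearMap.range (LinearMap.mulLeft F x) = ⊥ := by
      rw [← Submodule.finrank_eq_zero (R := F)]
      omega
    have : x ∈ LinearMap.range (LinearMap.mulLeft F x) := ⟨1, by simp⟩
    rwa [h0, Submodule.mem_bot] at this

/-- The augmentation ideal of a group algebra, as a subspace. -/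
def augmentationSubmodule (F Z : Type*) [Field F] [Group Z] [Fintype Z] :
    Submodule F (MonoidAlgebra F Z) where
  carrier := {a | ∑ u, a.coeff u = 0}
  add_mem' {a b} ha hb := by
    rw [Set.mem_ofPred_eq] at ha hb ⊢
    simp [Finset.sum_add_distrib, ha, hb]
  zero_mem' := by simp
  smul_mem' r a ha := by
    rw [Set.mem_ofPred_eq] at ha ⊢
    simp [← Finset.mul_sum, ha]

theorem mem_augmentationSubmodule {F Z : Type*} [Field F] [Group Z] [Fintype Z]
    {a : MonoidAlgebra F Z} : a ∈ augmentationSubmodule F Z ↔ ∑ u, a.coeff u = 0 :=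
  Iff.rfl

theorem augmentationSubmodule_pow_card {F Z : Type*} [Field F] [Group Z] [Fintype Z] {p : ℕ}
    [Fact p.Prime] [CharP F p] (hZ : IsPGroup p Z) (hcomm : ∀ u v : Z, u * v = v * u) :
    augmentationSubmodule F Z ^ Fintype.card Z = ⊥ := by
  have hfin : Module.finrank F (MonoidAlgebra F Z) = Fintype.card Z :=
    Module.finrank_eq_card_basis (MonoidAlgebra.basis Z F)
  have : FiniteDimensional F (MonoidAlgebra F Z) :=
    Module.Finite.of_basis (MonoidAlgebra.basis Z F)
  have hc (a b : MonoidAlgebra F Z) : Commute a b := by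
    induction a using MonoidAlgebra.induction_on with
    | of u =>
      induction b using MonoidAlgebra.induction_on with
      | of v => simp [Commute, SemiconjBy, hcomm u v]
      | add a b ha hb => exact ha.add_right hb
      | smul r a ha => exact ha.smul_right r
    | add a b ha hb => exact ha.add_left hb
    | smul r a ha => exact ha.smul_left r
  have : CharP (MonoidAlgebra F Z) p := charP_of_injective_algebraMap' F p
  rw [← hfin]
  refine Submodule.pow_finrank_eq_bot_of_commute_of_isNilpotent _ (fun a _ b _ => hc a b)
    fun a ha => ?_
  have hsum : a = ∑ u, a.coeff u • (single u (1 : F) - 1) := by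
    simp only [smul_sub, Finset.sum_sub_distrib, ← Finset.sum_smul,
      mem_augmentationSubmodule.1 ha, zero_smul, sub_zero]
    ext t
    simp
  rw [hsum]
  refine Commute.isNilpotent_sum (fun u _ => ?_) fun _ _ _ _ => hc _ _
  refine IsNilpotent.smul ?_ _
  obtain ⟨k, hk⟩ := hZ u
  refine ⟨p ^ k, ?_⟩
  rw [sub_pow_char_pow_of_commute _ _ (hc _ _), single_pow, hk]
  simp [one_def]

/-! ### Elements whose centralizer has a given central Sylow `p`-subgroup -/

/-- Every `p`-element of the centralizer of `c` lies in `Z`. -/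
def CentralizerPElementsLE {C : Type*} [Group C] (p : ℕ) (Z : Subgroup C) (c : C) : Prop :=
  ∀ r : C, (∃ k, r ^ p ^ k = 1) → Commute r c → r ∈ Z

namespace CentralizerPElementsLE

variable {C : Type*} [Group C] {p : ℕ} {Z : Subgroup C}

theorem mul_iff (hZ : Z ≤ Subgroup.center C) {u : C} (hu : u ∈ Z) {c : C} :
    CentralizerPElementsLE p Z (u * c) ↔ CentralizerPElementsLE p Z c := by
  refine forall_congr' fun r => forall_congr' fun _ => ?_
  have hru : Commute r u := Subgroup.mem_center_iff.1 (hZ hu) r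
  refine ⟨fun h hr => h (hru.mul_right hr), fun h hr => h ?_⟩
  simpa using hru.inv_right.mul_right hr

theorem conj (hZ : Z ≤ Subgroup.center C) {c : C} (hc : CentralizerPElementsLE p Z c) (g : C) :
    CentralizerPElementsLE p Z (g * c * g⁻¹) := by
  rintro r ⟨k, hk⟩ hr
  have h1 : g⁻¹ * r * g ∈ Z := by
    refine hc _ ⟨k, ?_⟩ ?_
    · have := conj_pow (a := g⁻¹) (b := r) (i := p ^ k)
      rw [inv_inv] at this
      rw [this, hk]
      simp
    · have := congrArg (fun x => g⁻¹ * x * g) hr.eq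
      simp only [mul_assoc, inv_mul_cancel, mul_one, inv_mul_cancel_left] at this
      rw [Commute, SemiconjBy]
      simpa [mul_assoc] using this
  have h2 := Subgroup.mem_center_iff.1 (hZ h1) g
  have h3 : r = g⁻¹ * r * g := by
    have : g * (g⁻¹ * r * g) = r * g := by group
    rw [this] at h2
    exact mul_right_cancel h2
  rwa [h3]

end CentralizerPElementsLE

theorem eq_one_of_mul_eq_of_coprime_orderOf {C : Type*} [Group C] [Finite C] {p : ℕ}
    {Z : Subgroup C} (hZ : Z ≤ Subgroup.center C) (hZp : IsPGroup p Z) {v s t : C} (hv : v ∈ Z)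
    (hs : (orderOf s).Coprime p) (ht : (orderOf t).Coprime p) (h : v * s = t) : v = 1 := by
  obtain ⟨k, hk⟩ := hZp ⟨v, hv⟩
  have hk : v ^ p ^ k = 1 := congrArg Subtype.val hk
  have hvs : Commute v s := (Subgroup.mem_center_iff.1 (hZ hv) s).symm
  have hm : v ^ (orderOf s * orderOf t) = 1 := by
    have h1 := hvs.mul_pow (orderOf s * orderOf t)
    rwa [h, pow_mul s, pow_orderOf_eq_one, one_pow, mul_one, mul_comm, pow_mul t,
      pow_orderOf_eq_one, one_pow, mul_comm, eq_comm] at h1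
  rw [← orderOf_eq_one_iff]
  exact Nat.eq_one_of_dvd_coprimes ((Nat.Coprime.mul_left hs ht).pow_right k)
    (orderOf_dvd_of_pow_eq_one hm) (orderOf_dvd_of_pow_eq_one hk)

theorem CentralizerPElementsLE.exists_eq_mul {C : Type*} [Group C] [Finite C] {p : ℕ}
    (hp : p.Prime) {Z : Subgroup C} {c : C} (hc : CentralizerPElementsLE p Z c) :
    ∃ u ∈ Z, ∃ s : C, (orderOf s).Coprime p ∧ c = u * s := by
  have hcard : Nat.card C ≠ 0 := Nat.card_pos.ne'
  set n := Nat.card C with hn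
  have hco : (p ^ n.factorization p).Coprime (n / p ^ n.factorization p) :=
    (Nat.coprime_ordCompl hp hcard).pow_left _
  obtain ⟨M, hM1, hM2⟩ := Nat.chineseRemainder hco 0 1
  set m := n / p ^ n.factorization p with hm
  have hnm : p ^ n.factorization p * m = n := Nat.ordProj_mul_ordCompl_eq_self n p
  have hu : (c * (c ^ M)⁻¹) ^ p ^ n.factorization p = 1 := by
    have h1 : Commute c (c ^ M)⁻¹ := ((Commute.refl c).pow_right M).inv_right
    rw [h1.mul_pow, inv_pow, ← pow_mul, mul_inv_eq_one, pow_eq_pow_iff_modEq]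
    have : p ^ n.factorization p ≡ p ^ n.factorization p * M [MOD n] := by
      have := hM2.symm.mul_left' (p ^ n.factorization p)
      rwa [mul_one, hnm] at this
    rw [mul_comm M]
    exact this.of_dvd (orderOf_dvd_natCard c)
  refine ⟨c * (c ^ M)⁻¹, hc _ ⟨_, hu⟩ ?_, c ^ M, ?_, by simp⟩
  · exact (Commute.refl c).mul_left ((Commute.refl c).pow_left M).inv_left
  · refine Nat.Coprime.of_dvd_left (a₂ := m) (orderOf_dvd_of_pow_eq_one ?_) ?_
    · rw [← pow_mul, ← orderOf_dvd_iff_pow_eq_one]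
      refine (orderOf_dvd_natCard c).trans ?_
      rw [← hn, ← hnm]
      exact mul_dvd_mul (Nat.modEq_zero_iff_dvd.1 hM1) dvd_rfl
    · exact (Nat.coprime_ordCompl hp hcard).symm

theorem CentralizerPElementsLE.not_dvd_card_centralizer_quotient {C : Type*} [Group C] [Finite C]
    {p : ℕ} [Fact p.Prime] {Z : Subgroup C} [Z.Normal] (hZ : Z ≤ Subgroup.center C)
    (hZp : IsPGroup p Z) {c : C} (hc : CentralizerPElementsLE p Z c) :
    ¬ p ∣ Nat.card (Subgroup.centralizer {(QuotientGroup.mk c : C ⧸ Z)}) := by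
  intro hdvd
  obtain ⟨⟨x, hx⟩, hxo⟩ := exists_prime_orderOf_dvd_card' p hdvd
  obtain ⟨g, rfl⟩ := QuotientGroup.mk_surjective x
  rw [Subgroup.mem_centralizer_singleton_iff] at hx
  rw [Subgroup.orderOf_mk] at hxo
  obtain ⟨u, hu, s, hs, rfl⟩ := hc.exists_eq_mul Fact.out
  have huc := Subgroup.mem_center_iff.1 (hZ hu)
  have hv : g * s * g⁻¹ * s⁻¹ ∈ Z := by
    rw [← QuotientGroup.eq_one_iff]
    have hu1 : (QuotientGroup.mk (u * s) : C ⧸ Z) = QuotientGroup.mk s := by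
      rw [QuotientGroup.mk_mul, (QuotientGroup.eq_one_iff u).2 hu, one_mul]
    rw [hu1] at hx
    simp only [QuotientGroup.mk_mul, QuotientGroup.mk_inv]
    rw [hx]
    group
  have hv1 := eq_one_of_mul_eq_of_coprime_orderOf hZ hZp hv hs
    (t := g * s * g⁻¹) (by rwa [show g * s * g⁻¹ = MulAut.conj g s from rfl,
      MulEquiv.orderOf_eq]) (by group)
  have hgs : Commute g s := by
    rw [mul_inv_eq_one, mul_inv_eq_iff_eq_mul] at hv1
    exact hv1
  have hgp : g ^ p ∈ Z := by
    rw [← QuotientGroup.eq_one_iff, QuotientGroup.mk_pow, ← hxo, pow_orderOf_eq_one]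
  obtain ⟨k, hk⟩ := hZp ⟨_, hgp⟩
  have hk : (g ^ p) ^ p ^ k = 1 := congrArg Subtype.val hk
  have hgZ : g ∈ Z := hc g ⟨k + 1, by rw [pow_succ', pow_mul, hk]⟩
    ((show Commute g u from huc g).mul_right hgs)
  rw [(QuotientGroup.eq_one_iff g).2 hgZ, orderOf_one] at hxo
  exact (Fact.out : p.Prime).one_lt.ne hxo

/-! ### Multiplying by nilpotent central elements -/

/-- The central elements of the group algebra supported on elements whose centralizer has all its
`p`-elements in `Z`. -/
def centralDefectSubmodule (F : Type*) [Field F] {C : Type*} [Group C] (p : ℕ) (Z : Subgroup C) :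
    Submodule F (MonoidAlgebra F C) where
  carrier := {y | y ∈ Subalgebra.center F (MonoidAlgebra F C) ∧
    ∀ c, y.coeff c ≠ 0 → CentralizerPElementsLE p Z c}
  add_mem' {a b} ha hb := by
    refine ⟨add_mem ha.1 hb.1, fun c hc => ?_⟩
    by_cases h : a.coeff c = 0
    · exact hb.2 c (by simpa [h] using hc)
    · exact ha.2 c h
  zero_mem' := ⟨zero_mem _, by simp⟩
  smul_mem' r a ha := ⟨Subalgebra.smul_mem _ ha.1 r, fun c hc => ha.2 c fun h => hc (by simp [h])⟩

section CentralDefect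

variable {F : Type*} [Field F] {C : Type*} [Group C] {p : ℕ} {Z : Subgroup C}

theorem mul_mem_centralDefectSubmodule [Fintype C] [Fact p.Prime] [CharP F p]
    {y z : MonoidAlgebra F C} (hy : y ∈ centralDefectSubmodule F p Z)
    (hz : z ∈ Subalgebra.center F (MonoidAlgebra F C)) :
    y * z ∈ centralDefectSubmodule F p Z := by
  refine ⟨mul_mem hy.1 hz, fun c hc r hr hrc => ?_⟩
  by_contra hrZ
  refine hc ?_
  have hQ : IsPGroup p (Subgroup.zpowers r) := by
    obtain ⟨k, hk⟩ := hr
    obtain ⟨j, -, hj⟩ := (Nat.dvd_prime_pow Fact.out).1 (orderOf_dvd_of_pow_eq_one hk)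
    exact IsPGroup.of_card (n := j) (by rw [Nat.card_zpowers, hj])
  rw [coeff_mul_eq_sum_centralizer hy.1 hz hQ]
  · refine Finset.sum_eq_zero fun g _ => ?_
    split_ifs with hg
    · rw [Subgroup.mem_centralizer_iff] at hg
      have : y.coeff g = 0 := by
        by_contra h
        exact hrZ (hy.2 g h r hr (hg r (Subgroup.mem_zpowers r)))
      rw [this, zero_mul]
    · rfl
  · rw [Subgroup.mem_centralizer_iff]
    rintro _ ⟨i, rfl⟩
    exact (hrc.zpow_left i).eq

theorem coeff_mapDomain_mk [Fintype C] [Z.Normal] (x : MonoidAlgebra F C) (c : C) :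
    (mapDomainAlgHom F F (QuotientGroup.mk' Z) x).coeff (QuotientGroup.mk c) =
      ∑ u : Z, x.coeff (u * c) := by
  have h1 : x = ∑ g, single g (x.coeff g) := by
    ext t
    simp
  conv_lhs => rw [h1]
  rw [map_sum, coeff_sum, Finsupp.finsetSum_apply]
  simp only [mapDomainAlgHom_apply, mapDomain_single, coeff_single, Finsupp.single_apply]
  rw [← Finset.sum_filter]
  refine (Finset.sum_bij (fun (u : Z) _ => (u : C) * c) ?_ ?_ ?_ ?_).symm
  · intro u _
    rw [Finset.mem_filter]
    refine ⟨Finset.mem_univ _, ?_⟩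
    change (QuotientGroup.mk ((u : C) * c) : C ⧸ Z) = _
    rw [QuotientGroup.mk_mul, (QuotientGroup.eq_one_iff (u : C)).2 u.2, one_mul]
  · intro u _ v _ h
    exact Subtype.ext (mul_right_cancel h)
  · intro g hg
    have h2 : (QuotientGroup.mk g : C ⧸ Z) = QuotientGroup.mk c := (Finset.mem_filter.1 hg).2
    have h3 : g * c⁻¹ ∈ Z := by
      rw [← QuotientGroup.eq_one_iff, QuotientGroup.mk_mul, h2, QuotientGroup.mk_inv,
        mul_inv_cancel]
    exact ⟨⟨_, h3⟩, Finset.mem_univ _, by simp⟩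
  · intros; rfl

theorem mapDomain_mk_mem_center [Z.Normal] {x : MonoidAlgebra F C}
    (hx : x ∈ Subalgebra.center F (MonoidAlgebra F C)) :
    mapDomainAlgHom F F (QuotientGroup.mk' Z) x ∈
      Subalgebra.center F (MonoidAlgebra F (C ⧸ Z)) := by
  rw [mem_center_iff_commute_single] at hx ⊢
  intro g
  obtain ⟨g, rfl⟩ := QuotientGroup.mk_surjective g
  have := congrArg (mapDomainAlgHom F F (QuotientGroup.mk' Z)) (hx g)
  simpa only [map_mul, mapDomainAlgHom_apply, mapDomain_single, QuotientGroup.mk'_apply] using this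

theorem sum_coeff_mul_eq_zero [Fintype C] [Fact p.Prime] [CharP F p]
    (hZ : Z ≤ Subgroup.center C) (hZp : IsPGroup p Z) {y z : MonoidAlgebra F C}
    (hy : y ∈ centralDefectSubmodule F p Z)
    (hz : z ∈ Subalgebra.center F (MonoidAlgebra F C)) (hnil : IsNilpotent z) (c : C) :
    ∑ u : Z, (y * z).coeff (u * c) = 0 := by
  have hnorm : Z.Normal := ⟨fun u hu g => by
    rw [Subgroup.mem_center_iff.1 (hZ hu) g]; simpa using hu⟩
  rw [← coeff_mapDomain_mk, map_mul,
    mul_eq_zero_of_isNilpotent_of_defect_zero (mapDomain_mk_mem_center hy.1) ?_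
      (mapDomain_mk_mem_center hz) (hnil.map _)]
  · simp
  · intro h hne
    obtain ⟨c, rfl⟩ := QuotientGroup.mk_surjective h
    rw [coeff_mapDomain_mk] at hne
    obtain ⟨u, -, hu⟩ := Finset.exists_ne_zero_of_sum_ne_zero hne
    have hc := (CentralizerPElementsLE.mul_iff hZ u.2).1 (hy.2 _ hu)
    rw [Ne, CharP.cast_eq_zero_iff F p]
    exact hc.not_dvd_card_centralizer_quotient hZ hZp

/-- The sum of the elements of a conjugacy class, as an element of the group algebra. -/
noncomputable def conjSum (F : Type*) [Field F] {C : Type*} [Group C] [Fintype C] (s : C) :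
    MonoidAlgebra F C :=
  ∑ x, if IsConj s x then single x 1 else 0

theorem coeff_conjSum [Fintype C] (s x : C) :
    (conjSum F s).coeff x = if IsConj s x then 1 else 0 := by
  simp only [conjSum, coeff_sum, Finsupp.finsetSum_apply]
  rw [Finset.sum_eq_single x]
  · split_ifs <;> simp
  · intro b _ hb
    split_ifs <;> simp [hb]
  · simp

theorem conjSum_mem [Fintype C] (hZ : Z ≤ Subgroup.center C) {s : C}
    (hs : CentralizerPElementsLE p Z s) : conjSum F s ∈ centralDefectSubmodule F p Z := by
  refine ⟨mem_center_iff_coeff_conj.2 fun g h => ?_, fun c hc => ?_⟩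
  · rw [coeff_conjSum, coeff_conjSum]
    have h1 : IsConj h (g * h * g⁻¹) := isConj_iff.2 ⟨g, rfl⟩
    exact if_congr ⟨fun h2 => h2.trans h1.symm, fun h2 => h2.trans h1⟩ rfl rfl
  · have h1 : IsConj s c := by
      by_contra h
      exact hc (by rw [coeff_conjSum, if_neg h])
    obtain ⟨g, rfl⟩ := isConj_iff.1 h1
    exact hs.conj hZ g

/-- The image of the augmentation ideal of the group algebra of a subgroup. -/
noncomputable def augmentationImage (F : Type*) [Field F] {C : Type*} [Group C] [Fintype C]
    (Z : Subgroup C) : Submodule F (MonoidAlgebra F C) :=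
  (augmentationSubmodule F Z).map (mapDomainAlgHom F F Z.subtype).toLinearMap

theorem mem_augmentationImage_mul [Fintype C] [Fact p.Prime]
    (hZ : Z ≤ Subgroup.center C) (hZp : IsPGroup p Z) {w : MonoidAlgebra F C}
    (hw : w ∈ centralDefectSubmodule F p Z) (h0 : ∀ c, ∑ u : Z, w.coeff (u * c) = 0) :
    w ∈ augmentationImage F Z * centralDefectSubmodule F p Z := by
  let a : C → MonoidAlgebra F Z := fun s => ∑ u : Z, single u (w.coeff (u * s))
  have ha (s : C) : mapDomainAlgHom F F Z.subtype (a s) ∈ augmentationImage F Z := by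
    refine ⟨a s, ?_, rfl⟩
    rw [SetLike.mem_coe, mem_augmentationSubmodule, ← h0 s]
    refine Finset.sum_congr rfl fun u _ => ?_
    simp [a, Finsupp.single_apply]
  have hsum : w = ∑ k : ConjClasses C,
      if (orderOf k.out).Coprime p ∧ CentralizerPElementsLE p Z k.out then
        mapDomainAlgHom F F Z.subtype (a k.out) * conjSum F k.out else 0 := by
    have hcoeff (s c : C) : (mapDomainAlgHom F F Z.subtype (a s) * conjSum F s).coeff c =
        ∑ u : Z, if IsConj s ((u : C)⁻¹ * c) then w.coeff (u * s) else 0 := by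
      simp only [a, map_sum, mapDomainAlgHom_apply, mapDomain_single, Finset.sum_mul, coeff_sum,
        Finsupp.finsetSum_apply, coeff_single_mul_apply, coeff_conjSum, mul_ite, mul_one, mul_zero,
        Subgroup.subtype_apply]
    have hout (s : C) : IsConj (ConjClasses.mk s).out s :=
      ConjClasses.mk_eq_mk_iff_isConj.1 (Quotient.out_eq (ConjClasses.mk s))
    have horder {s t : C} (h : IsConj s t) : orderOf s = orderOf t := by
      obtain ⟨g, rfl⟩ := isConj_iff.1 h
      exact (MulEquiv.orderOf_eq (MulAut.conj g) s).symm
    ext c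
    rw [coeff_sum, Finsupp.finsetSum_apply]
    by_cases hc : CentralizerPElementsLE p Z c
    · obtain ⟨u, hu, s, hs, rfl⟩ := hc.exists_eq_mul Fact.out
      have huniq {k : ConjClasses C} {v : Z} (hk : (orderOf k.out).Coprime p)
          (hkv : IsConj k.out ((v : C)⁻¹ * (u * s))) : (v : C) = u ∧ k = ConjClasses.mk s := by
        have h1 : (v : C)⁻¹ * u = 1 :=
          eq_one_of_mul_eq_of_coprime_orderOf hZ hZp (Z.mul_mem (Z.inv_mem v.2) hu) hs
            (horder hkv ▸ hk) (mul_assoc _ _ _)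
        refine ⟨inv_mul_eq_one.1 h1, ?_⟩
        rw [← mul_assoc, h1, one_mul] at hkv
        rw [← ConjClasses.mk_eq_mk_iff_isConj.2 hkv]
        exact (Quotient.out_eq k).symm
      obtain ⟨g, hg⟩ := isConj_iff.1 (hout s)
      have hs' : CentralizerPElementsLE p Z (ConjClasses.mk s).out := by
        obtain ⟨g, hg⟩ := isConj_iff.1 (hout s).symm
        rw [← hg]
        exact ((CentralizerPElementsLE.mul_iff hZ hu).1 hc).conj hZ g
      rw [Fintype.sum_eq_single (ConjClasses.mk s), if_pos ⟨horder (hout s) ▸ hs, hs'⟩, hcoeff,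
        Fintype.sum_eq_single ⟨u, hu⟩, if_pos]
      · have hgu := Subgroup.mem_center_iff.1 (hZ hu) g
        have hconj : u * s = g * (u * (ConjClasses.mk s).out) * g⁻¹ := by
          rw [← mul_assoc g, hgu, mul_assoc u, mul_assoc u, hg]
        rw [hconj, mem_center_iff_coeff_conj.1 hw.1]
      · simpa using hout s
      · intro v hv
        refine if_neg fun h => hv (Subtype.ext ?_)
        exact (huniq (horder (hout s) ▸ hs) h).1
      · intro k hk
        split_ifs with h
        · rw [hcoeff]
          refine Finset.sum_eq_zero fun v _ => if_neg fun h1 => hk (huniq h.1 h1).2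
        · rfl
    · have hwc : w.coeff c = 0 := by
        by_contra h
        exact hc (hw.2 c h)
      rw [hwc, eq_comm]
      refine Finset.sum_eq_zero fun k _ => ?_
      split_ifs with h
      · rw [hcoeff]
        refine Finset.sum_eq_zero fun v _ => if_neg fun h1 => hc ?_
        obtain ⟨g, hg⟩ := isConj_iff.1 h1
        rw [← CentralizerPElementsLE.mul_iff hZ (Z.inv_mem v.2), ← hg]
        exact h.2.conj hZ g
      · rfl
  rw [hsum]
  refine Submodule.sum_mem _ fun k _ => ?_
  split_ifs with hk
  · exact Submodule.mul_mem_mul (ha _) (conjSum_mem hZ hk.2)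
  · exact Submodule.zero_mem _

theorem centralDefectSubmodule_mul_pow_le [Fintype C] [Fact p.Prime] [CharP F p]
    (hZ : Z ≤ Subgroup.center C) (hZp : IsPGroup p Z) {B : Submodule F (MonoidAlgebra F C)}
    (hB : ∀ b ∈ B, b ∈ Subalgebra.center F (MonoidAlgebra F C) ∧ IsNilpotent b) (n : ℕ) :
    centralDefectSubmodule F p Z * B ^ n ≤
      augmentationImage F Z ^ n * centralDefectSubmodule F p Z := by
  induction n with
  | zero => simp
  | succ n ih =>
    calc centralDefectSubmodule F p Z * B ^ (n + 1)
        = centralDefectSubmodule F p Z * B ^ n * B := by rw [pow_succ, mul_assoc]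
      _ ≤ augmentationImage F Z ^ n * centralDefectSubmodule F p Z * B :=
        mul_le_mul' ih le_rfl
      _ = augmentationImage F Z ^ n * (centralDefectSubmodule F p Z * B) := mul_assoc _ _ _
      _ ≤ augmentationImage F Z ^ n * (augmentationImage F Z * centralDefectSubmodule F p Z) := by
        refine mul_le_mul' le_rfl (Submodule.mul_le.2 fun y hy b hb => ?_)
        obtain ⟨hbc, hbn⟩ := hB b hb
        exact mem_augmentationImage_mul hZ hZp (mul_mem_centralDefectSubmodule hy hbc)
          (sum_coeff_mul_eq_zero hZ hZp hy hbc hbn)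
      _ = _ := by rw [← mul_assoc, pow_succ]

theorem centralDefectSubmodule_mul_pow_eq_bot [Fintype C] [Fact p.Prime] [CharP F p]
    (hZ : Z ≤ Subgroup.center C) (hZp : IsPGroup p Z) {B : Submodule F (MonoidAlgebra F C)}
    (hB : ∀ b ∈ B, b ∈ Subalgebra.center F (MonoidAlgebra F C) ∧ IsNilpotent b) {n : ℕ}
    (hn : Fintype.card Z ≤ n) :
    centralDefectSubmodule F p Z * B ^ n = ⊥ := by
  have h := augmentationSubmodule_pow_card (F := F) hZp fun u v =>
    Subtype.ext (Subgroup.mem_center_iff.1 (hZ v.2) u)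
  have h1 : augmentationImage F Z ^ n = ⊥ := by
    obtain ⟨m, rfl⟩ := Nat.exists_eq_add_of_le hn
    rw [pow_add, augmentationImage, ← Submodule.map_pow, h, Submodule.map_bot, Submodule.bot_mul]
  rw [eq_bot_iff]
  refine (centralDefectSubmodule_mul_pow_le hZ hZp hB n).trans ?_
  rw [h1, Submodule.bot_mul]

end CentralDefect

/-! ### The Brauer homomorphism -/

section Brauer

variable {F G : Type*} [Field F] [Group G] [Fintype G] {p : ℕ} [Fact p.Prime] [CharP F p]
  {Q : Subgroup G}

/-- The Brauer homomorphism of a `p`-subgroup `Q`, from the center of the group algebra of `G` to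
the group algebra of the centralizer of `Q`. -/
noncomputable def brauerHom (F : Type*) {G : Type*} [Field F] [Group G] [Fintype G] {p : ℕ}
    [Fact p.Prime] [CharP F p] {Q : Subgroup G} (hQ : IsPGroup p Q) :
    Subalgebra.center F (MonoidAlgebra F G) →ₐ[F]
      MonoidAlgebra F (Subgroup.centralizer (Q : Set G)) :=
  AlgHom.ofLinearMap
    { toFun := fun x => comapDomain Subtype.val Subtype.val_injective x.1
      map_add' := fun x y => by ext; simp
      map_smul' := fun r x => by ext; simp }
    (by
      ext c
      change (1 : MonoidAlgebra F G).coeff c = _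
      simp only [one_def, coeff_single, Finsupp.single_apply, ← Subtype.val_inj,
        Subgroup.coe_one])
    (fun x y => by
      ext c
      have := coeff_mul_eq_sum_centralizer x.2 y.2 hQ c.2
      simp only [LinearMap.coe_mk, AddHom.coe_mk, coeff_comapDomain, coeff_mul_eq_sum]
      simp only [MulMemClass.coe_mul, Finsupp.comapDomain_apply, this]
      rw [← Finset.sum_filter]
      exact Finset.sum_subtype _ (fun g => by
        rw [Finset.mem_filter, and_iff_right (Finset.mem_univ g)]) _)

theorem coeff_brauerHom (hQ : IsPGroup p Q) (x : Subalgebra.center F (MonoidAlgebra F G))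
    (c : Subgroup.centralizer (Q : Set G)) :
    (brauerHom F hQ x).coeff c = (x : MonoidAlgebra F G).coeff c := by
  simp [brauerHom]

theorem brauerHom_mem_center (hQ : IsPGroup p Q) (x : Subalgebra.center F (MonoidAlgebra F G)) :
    brauerHom F hQ x ∈
      Subalgebra.center F (MonoidAlgebra F (Subgroup.centralizer (Q : Set G))) := by
  rw [mem_center_iff_coeff_conj]
  intro g h
  rw [coeff_brauerHom, coeff_brauerHom]
  exact mem_center_iff_coeff_conj.1 x.2 g h

/-- The central elements killed by the Brauer homomorphisms of all `p`-subgroups of order at least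
`p ^ k`. -/
noncomputable def brauerKernel (F G : Type*) [Field F] [Group G] [Fintype G] (p : ℕ)
    [Fact p.Prime] [CharP F p] (k : ℕ) : Submodule F (Subalgebra.center F (MonoidAlgebra F G)) :=
  ⨅ (Q : Subgroup G) (hQ : IsPGroup p Q) (_ : p ^ k ≤ Nat.card Q),
    LinearMap.ker (brauerHom F hQ).toLinearMap

theorem mem_brauerKernel {k : ℕ} {x : Subalgebra.center F (MonoidAlgebra F G)} :
    x ∈ brauerKernel F G p k ↔
      ∀ (Q : Subgroup G) (hQ : IsPGroup p Q), p ^ k ≤ Nat.card Q → brauerHom F hQ x = 0 := by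
  simp [brauerKernel]

theorem brauerKernel_zero : brauerKernel F G p 0 = ⊥ := by
  rw [eq_bot_iff]
  intro x hx
  have h := mem_brauerKernel.1 hx ⊥ IsPGroup.of_bot (by simp)
  rw [Submodule.mem_bot]
  ext c
  have hc : c ∈ Subgroup.centralizer ((⊥ : Subgroup G) : Set G) := by
    simp [Subgroup.mem_centralizer_iff]
  rw [← coeff_brauerHom IsPGroup.of_bot x ⟨c, hc⟩, h]
  rfl

theorem brauerHom_mem_centralDefectSubmodule {k : ℕ}
    {x : Subalgebra.center F (MonoidAlgebra F G)} (hx : x ∈ brauerKernel F G p (k + 1))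
    (hQ : IsPGroup p Q) (hcard : Nat.card Q = p ^ k) :
    brauerHom F hQ x ∈
      centralDefectSubmodule F p (Q.subgroupOf (Subgroup.centralizer (Q : Set G))) := by
  refine ⟨brauerHom_mem_center hQ x, fun c hc r ⟨j, hj⟩ hrc => ?_⟩
  rw [Subgroup.mem_subgroupOf]
  by_contra hrQ
  have hR : IsPGroup p (Subgroup.zpowers (r : G)) := by
    obtain ⟨i, -, hi⟩ := (Nat.dvd_prime_pow Fact.out).1 (orderOf_dvd_of_pow_eq_one hj)
    exact IsPGroup.of_card (n := i) (by rw [Nat.card_zpowers, Subgroup.orderOf_coe, hi])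
  have hle : Subgroup.zpowers (r : G) ≤ Subgroup.normalizer (Q : Set G) :=
    (Subgroup.zpowers_le.2 r.2).trans (Subgroup.centralizer_le_normalizer _)
  have hS : IsPGroup p (Subgroup.zpowers (r : G) ⊔ Q : Subgroup G) :=
    hR.to_sup_of_normal_right' hQ hle
  have hlt : Q < Subgroup.zpowers (r : G) ⊔ Q := by
    refine lt_of_le_of_ne le_sup_right fun h => hrQ ?_
    exact h.ge (Subgroup.mem_sup_left (Subgroup.mem_zpowers _))
  have hbig : p ^ (k + 1) ≤ Nat.card (Subgroup.zpowers (r : G) ⊔ Q : Subgroup G) := by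
    obtain ⟨i, hi⟩ := IsPGroup.iff_card.1 hS
    have h1 : Nat.card Q < Nat.card (Subgroup.zpowers (r : G) ⊔ Q : Subgroup G) :=
      Set.ncard_lt_ncard hlt
    rw [hi]
    rw [hcard, hi] at h1
    exact Nat.pow_le_pow_right (Fact.out : p.Prime).pos
      ((Nat.pow_lt_pow_iff_right (Fact.out : p.Prime).one_lt).1 h1)
  have hcS : (c : G) ∈
      Subgroup.centralizer ((Subgroup.zpowers (r : G) ⊔ Q : Subgroup G) : Set G) := by
    have h1 : Subgroup.zpowers (r : G) ⊔ Q ≤ Subgroup.centralizer {(c : G)} := by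
      rw [sup_le_iff, Subgroup.zpowers_le, Subgroup.mem_centralizer_singleton_iff]
      exact ⟨congrArg Subtype.val hrc.eq, fun q hq =>
        Subgroup.mem_centralizer_singleton_iff.2 (Subgroup.mem_centralizer_iff.1 c.2 q hq)⟩
    rw [Subgroup.mem_centralizer_iff]
    exact fun q hq => Subgroup.mem_centralizer_singleton_iff.1 (h1 hq)
  have h0 := mem_brauerKernel.1 hx _ hS hbig
  refine hc ?_
  rw [coeff_brauerHom, ← coeff_brauerHom hS x ⟨c, hcS⟩, h0]
  rfl

theorem brauerKernel_succ_mul_pow_le {J : Submodule F (Subalgebra.center F (MonoidAlgebra F G))}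
    (hJ : ∀ w ∈ J, IsNilpotent w) (k : ℕ) :
    brauerKernel F G p (k + 1) * J ^ p ^ k ≤ brauerKernel F G p k := by
  rw [Submodule.mul_le]
  intro x hx w hw
  rw [mem_brauerKernel]
  intro Q hQ hk
  rw [map_mul]
  by_cases hk' : p ^ (k + 1) ≤ Nat.card Q
  · rw [mem_brauerKernel.1 hx Q hQ hk', zero_mul]
  · have hcard : Nat.card Q = p ^ k := by
      obtain ⟨i, hi⟩ := IsPGroup.iff_card.1 hQ
      have hp := (Fact.out : p.Prime).one_lt
      rw [hi] at hk hk' ⊢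
      rw [Nat.pow_le_pow_iff_right hp] at hk hk'
      rw [show i = k by omega]
    have hZ : Q.subgroupOf (Subgroup.centralizer (Q : Set G)) ≤ Subgroup.center _ := by
      intro z hz
      rw [Subgroup.mem_center_iff]
      intro g
      exact Subtype.ext (Subgroup.mem_centralizer_iff.1 g.2 z hz).symm
    have hZp : IsPGroup p (Q.subgroupOf (Subgroup.centralizer (Q : Set G))) :=
      hQ.comap_of_injective _ (Subgroup.subtype_injective _)
    have hn : Fintype.card (Q.subgroupOf (Subgroup.centralizer (Q : Set G))) ≤ p ^ k := by
      rw [← Nat.card_eq_fintype_card, ← hcard]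
      exact Nat.card_le_card_of_injective (fun z => (⟨z.1.1, z.2⟩ : Q))
        fun a b h => Subtype.ext (Subtype.ext (congrArg (fun q : Q => (q : G)) h))
    have hbot := centralDefectSubmodule_mul_pow_eq_bot (F := F) hZ hZp
      (B := J.map (brauerHom F hQ).toLinearMap) ?_ hn
    · rw [← Submodule.mem_bot F, ← hbot]
      refine Submodule.mul_mem_mul (brauerHom_mem_centralDefectSubmodule hx hQ hcard) ?_
      rw [← Submodule.map_pow]
      exact Submodule.mem_map_of_mem hw
    · rintro _ ⟨w, hw, rfl⟩
      exact ⟨brauerHom_mem_center hQ w, (hJ w hw).map (brauerHom F hQ)⟩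

theorem brauerKernel_mul_pow_eq_bot {J : Submodule F (Subalgebra.center F (MonoidAlgebra F G))}
    (hJ : ∀ w ∈ J, IsNilpotent w) (k : ℕ) :
    brauerKernel F G p k * J ^ (∑ i ∈ Finset.range k, p ^ i) = ⊥ := by
  induction k with
  | zero => simp [brauerKernel_zero]
  | succ k ih =>
    rw [Finset.sum_range_succ, add_comm (Finset.sum _ _), pow_add, ← mul_assoc, eq_bot_iff, ← ih]
    exact mul_le_mul' (brauerKernel_succ_mul_pow_le hJ k) le_rfl

end Brauer

section DefectGroups

variable {F G : Type} [Field F] [Group G] [Fintype G] {p : ℕ}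

theorem coeff_classSum (K : ConjClasses G) (x : G) :
    (classSum F K).coeff x = if x ∈ K.carrier then 1 else 0 := by
  simp only [classSum, coeff_sum, Finsupp.finsetSum_apply]
  rw [Finset.sum_eq_single x]
  · split_ifs <;> simp
  · intro b _ hb
    split_ifs <;> simp [hb]
  · simp

theorem IsClassDefectGroup.card_le [Fact p.Prime] {P : Subgroup G} {K : ConjClasses G}
    (hP : IsClassDefectGroup p P K) {Q : Subgroup G} (hQ : IsPGroup p Q) {c : G}
    (hc : c ∈ K.carrier) (hcQ : c ∈ Subgroup.centralizer (Q : Set G)) :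
    Nat.card Q ≤ Nat.card P := by
  obtain ⟨x, hx, S, rfl⟩ := hP
  obtain ⟨g, rfl⟩ : ∃ g, g * c * g⁻¹ = x := by
    rw [ConjClasses.mem_carrier_iff_mk_eq] at hc hx
    exact isConj_iff.1 (ConjClasses.mk_eq_mk_iff_isConj.1 (hc.trans hx.symm))
  rw [Subgroup.card_map_of_injective (Subgroup.subtype_injective _)]
  let R := Q.map (MulAut.conj g).toMonoidHom
  have hR : R ≤ Subgroup.centralizer {g * c * g⁻¹} := by
    rintro _ ⟨q, hq, rfl⟩
    have := Subgroup.mem_centralizer_iff.1 hcQ q hq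
    rw [Subgroup.mem_centralizer_singleton_iff]
    simp only [MulEquiv.toMonoidHom_eq_coe, MonoidHom.coe_coe, MulAut.conj_apply]
    simp only [mul_assoc, inv_mul_cancel_left]
    rw [← mul_assoc q, this, mul_assoc]
  have hRp : IsPGroup p (R.subgroupOf (Subgroup.centralizer {g * c * g⁻¹})) :=
    (hQ.map _).comap_of_injective _ (Subgroup.subtype_injective _)
  obtain ⟨T, hT⟩ := hRp.exists_le_sylow
  calc Nat.card Q = Nat.card R :=
        (Subgroup.card_map_of_injective (MulAut.conj g).injective).symm
    _ = Nat.card (R.subgroupOf (Subgroup.centralizer {g * c * g⁻¹})) :=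
        (Nat.card_congr (Subgroup.subgroupOfEquivOfLe hR).toEquiv).symm
    _ ≤ Nat.card T := Subgroup.card_le_of_le hT
    _ = Nat.card S := Nat.card_congr (Sylow.equiv T S).toEquiv

theorem coeff_eq_zero_of_mem_classIdealLE [Fact p.Prime] {D : Subgroup G} {e : MonoidAlgebra F G}
    (he : e ∈ classIdealLE F p D) {Q : Subgroup G} (hQ : IsPGroup p Q)
    (hlt : Nat.card D < Nat.card Q) {c : G} (hc : c ∈ Subgroup.centralizer (Q : Set G)) :
    e.coeff c = 0 := by
  let N : Submodule F (MonoidAlgebra F G) :=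
    { carrier := {a | a.coeff c = 0}
      add_mem' := fun {a b} ha hb => by simp_all
      zero_mem' := by simp
      smul_mem' := fun r a ha => by simp_all }
  suffices classIdealLE F p D ≤ N from this he
  refine iSup₂_le fun P hP => Submodule.span_le.2 ?_
  rintro _ ⟨K, hK, rfl⟩
  change (classSum F K).coeff c = 0
  rw [coeff_classSum, if_neg]
  intro hcK
  exact absurd ((hK.card_le hQ hcK hc).trans (Subgroup.card_le_of_le hP)) hlt.not_ge

end DefectGroups

/-- If `D` is a `p`-subgroup of `G` with `|D| = p^d` and `e` is a central idempotent of `FG`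
lying in `I_{≤D}(G)`, then `e · J(Z(FG))^((p^(d+1)-1)/(p-1)) = 0`. -/
theorem stmt4 (F : Type) [Field F] [IsAlgClosed F] (G : Type) [Group G] [Fintype G]
    (p : ℕ) [Fact p.Prime] [CharP F p]
    (D : Subgroup G) (hD : IsPGroup p D) (d : ℕ) (hcard : Fintype.card ↥D = p ^ d)
    (e : MonoidAlgebra F G) (hcentral : e ∈ Subalgebra.center F (MonoidAlgebra F G))
    (hidem : IsIdempotentElem e) (hmem : e ∈ classIdealLE F p D) :
    ∀ x ∈ (JZ F G) ^ ((p ^ (d + 1) - 1) / (p - 1)), e * x = 0 := by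
  intro x hx
  have hp : p.Prime := Fact.out
  have : IsArtinianRing (Subalgebra.center F (MonoidAlgebra F G)) := .of_finite F _
  rw [← Nat.geomSum_eq hp.two_le, JZ] at hx
  change x ∈ Submodule.map (Subalgebra.center F (MonoidAlgebra F G)).val.toLinearMap _ ^ _ at hx
  rw [← Submodule.map_pow] at hx
  obtain ⟨w, hw, rfl⟩ := hx
  have he : (⟨e, hcentral⟩ : Subalgebra.center F (MonoidAlgebra F G)) ∈
      brauerKernel F G p (d + 1) := by
    rw [mem_brauerKernel]
    intro Q hQ hk
    ext c
    rw [coeff_brauerHom]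
    refine coeff_eq_zero_of_mem_classIdealLE hmem hQ ?_ c.2
    rw [Nat.card_eq_fintype_card, hcard]
    exact (Nat.pow_lt_pow_succ hp.one_lt).trans_le hk
  have hJ : ∀ w ∈ (Ideal.jacobson
      (⊥ : Ideal ↥(Subalgebra.center F (MonoidAlgebra F G)))).restrictScalars F,
      IsNilpotent w := by
    intro w hw
    obtain ⟨n, hn⟩ := IsArtinianRing.isNilpotent_jacobson_bot
      (R := Subalgebra.center F (MonoidAlgebra F G))
    refine ⟨n, ?_⟩
    have := Ideal.pow_mem_pow hw n
    rwa [hn] at this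
  have h := Submodule.mul_mem_mul he hw
  rw [brauerKernel_mul_pow_eq_bot hJ, Submodule.mem_bot] at h
  exact congrArg Subtype.val h
end

section
/- Let D be a p-subgroup of the finite group G with |D| = p^d > 1 and exponent p^m, let α := ⌊d/m⌋, and set N := m(p^m−1)·α(α+1)/2 + (α+1)·(p^m−1)/(p−1). If e is a central idempotent of FG with e ∈ I_{≤D}(G), then e · J(Z(FG))^N = 0; in particular, the Loewy length of Z(FG)·e is at most N. -/
set_option synthInstance.maxHeartbeats 1000000
set_option maxHeartbeats 1000000

open scoped Classical

section Orbits

variable {A X R : Type*} [Group A] [MulAction A X] [Fintype X]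

/-- A sum over a finite `A`-set vanishes as soon as its partial sums over all orbits vanish. -/
theorem sum_eq_zero_of_sum_orbit_eq_zero [AddCommMonoid R] (h : X → R)
    (horb : ∀ x : X, ∑ y : MulAction.orbit A x, h y = 0) : ∑ x, h x = 0 := by
  rw [← (MulAction.selfEquivSigmaOrbits A X).symm.sum_comp, Fintype.sum_sigma]
  refine Finset.sum_eq_zero fun ω _ => ?_
  rw [← horb ω.out]
  exact Finset.sum_congr rfl fun y _ => rfl

theorem sum_smul_eq_card_stabilizer_mul [Fintype A] [Semiring R] (h : X → R) (x : X) :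
    ∑ g : A, h (g • x) =
      (Nat.card (MulAction.stabilizer A x) : R) * ∑ y : MulAction.orbit A x, h y := by
  let o : A → MulAction.orbit A x := fun g => ⟨g • x, g, rfl⟩
  rw [← Finset.sum_fiberwise Finset.univ o, Finset.mul_sum]
  refine Finset.sum_congr rfl ?_
  rintro ⟨_, k, rfl⟩ -
  have hval : ∀ g ∈ Finset.univ.filter fun g => o g = ⟨k • x, k, rfl⟩, h (g • x) = h (k • x) := by
    intro g hg
    exact congrArg h (Subtype.ext_iff.1 (Finset.mem_filter.1 hg).2)
  rw [Finset.sum_congr rfl hval, Finset.sum_const, nsmul_eq_mul]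
  congr 2
  rw [Nat.card_eq_fintype_card, Fintype.card_subtype]
  refine Finset.card_nbij' (k⁻¹ * ·) (k * ·) ?_ ?_ ?_ ?_
  · intro g hg
    have : g • x = k • x := Subtype.ext_iff.1 (Finset.mem_filter.1 hg).2
    simp [mul_smul, this]
  · intro g hg
    have : g • x = x := (Finset.mem_filter.1 hg).2
    simp [o, mul_smul, this]
  · intro g _
    simp
  · intro g _
    simp

/-- In characteristic `p`, an invariant function on a finite set acted on by a `p`-group sums to
zero if it vanishes on the fixed points. -/
theorem IsPGroup.sum_eq_zero_of_fixedPoints [Semiring R] {p : ℕ} [Fact p.Prime] [CharP R p]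
    (hA : IsPGroup p A) (h : X → R) (hinv : ∀ (g : A) x, h (g • x) = h x)
    (hfix : ∀ x ∈ MulAction.fixedPoints A X, h x = 0) : ∑ x, h x = 0 := by
  refine sum_eq_zero_of_sum_orbit_eq_zero (A := A) h fun x => ?_
  have hc : ∀ y : MulAction.orbit A x, h y = h x := by
    rintro ⟨_, g, rfl⟩
    exact hinv g x
  rw [Finset.sum_congr rfl fun y _ => hc y, Finset.sum_const, Finset.card_univ,
    ← Nat.card_eq_fintype_card]
  obtain ⟨n, hn⟩ := hA.card_orbit x
  rcases n with _ | n
  · rw [hfix x, smul_zero]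
    rw [MulAction.mem_fixedPoints_iff_card_orbit_eq_one, ← Nat.card_eq_fintype_card, hn, pow_zero]
  · rw [hn, nsmul_eq_mul, pow_succ, Nat.cast_mul, CharP.cast_eq_zero R p, mul_zero, zero_mul]

end Orbits

section Center

variable {F H : Type*} [Field F] [Group H]

theorem MonoidAlgebra.coeff_mul_eq_sum [Fintype H] (a b : MonoidAlgebra F H) (z : H) :
    (a * b).coeff z = ∑ x, a.coeff x * b.coeff (x⁻¹ * z) := by
  rw [MonoidAlgebra.coeff_mul_apply_left, Finsupp.sum_fintype]
  simp

theorem MonoidAlgebra.mem_center_iff_coeff {a : MonoidAlgebra F H} :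
    a ∈ Subalgebra.center F (MonoidAlgebra F H) ↔
      ∀ g x, a.coeff (g * x * g⁻¹) = a.coeff x := by
  rw [Subalgebra.mem_center_iff]
  constructor
  · intro h g x
    have := congrArg (fun u => u.coeff (g * x)) (h (MonoidAlgebra.single g 1))
    simpa using this.symm
  · intro h b
    induction b using MonoidAlgebra.induction_linear with
    | zero => simp
    | add x y hx hy => rw [add_mul, mul_add, hx, hy]
    | single g r =>
      ext x
      have := h g⁻¹ (x * g⁻¹)
      simp only [inv_inv] at this
      have hx : a.coeff (g⁻¹ * x) = a.coeff (x * g⁻¹) := by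
        rw [← this]
        congr 1
        group
      simp [mul_comm r, hx]

theorem MonoidAlgebra.coeff_mul_comm_of_mem_center {a : MonoidAlgebra F H}
    (ha : a ∈ Subalgebra.center F (MonoidAlgebra F H)) (x y : H) :
    a.coeff (x * y) = a.coeff (y * x) := by
  rw [← MonoidAlgebra.mem_center_iff_coeff.1 ha y (x * y)]
  group

/-- Multiplicativity of the Brauer map. -/
theorem MonoidAlgebra.coeff_mul_eq_sum_centralizer [Fintype H] {p : ℕ} [Fact p.Prime] [CharP F p]
    {a b : MonoidAlgebra F H}
    (ha : a ∈ Subalgebra.center F (MonoidAlgebra F H))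
    (hb : b ∈ Subalgebra.center F (MonoidAlgebra F H)) {Q : Subgroup H} (hQ : IsPGroup p Q)
    {z : H} (hz : z ∈ Subgroup.centralizer (Q : Set H)) :
    (a * b).coeff z =
      ∑ x : Subgroup.centralizer (Q : Set H), a.coeff x * b.coeff ((x : H)⁻¹ * z) := by
  rw [MonoidAlgebra.coeff_mul_eq_sum]
  set f : H → F := fun x => a.coeff x * b.coeff (x⁻¹ * z) with hf
  set C := Subgroup.centralizer (Q : Set H)
  have hsub : ∑ x : C, f x = ∑ x : H, if x ∈ C then f x else 0 := by
    rw [← Finset.sum_filter]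
    exact (Finset.sum_subtype _ (fun x => by simp) f).symm
  have hzero : ∑ x : H, (f x - if x ∈ C then f x else 0) = 0 := by
    let _ : MulAction Q H := MulAction.compHom H (MulAut.conj.comp Q.subtype)
    have hsm : ∀ (q : Q) (x : H), q • x = q * x * (q : H)⁻¹ := fun q x => rfl
    refine hQ.sum_eq_zero_of_fixedPoints _ (fun q x => ?_) (fun x hx => ?_)
    · have hmem : q • x ∈ C ↔ x ∈ C := by
        have hC : ∀ (q : Q), ∀ y ∈ C, q • y = y := fun q y hy => by
          rw [hsm, hy q q.2, mul_inv_cancel_right]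
        refine ⟨fun h => ?_, fun h => (hC q x h).symm ▸ h⟩
        have := hC q⁻¹ _ h
        rw [inv_smul_smul] at this
        exact this ▸ h
      have hfx : f (q • x) = f x := by
        have hqz : (q : H) * z = z * q := hz q q.2
        simp only [hf, hsm, MonoidAlgebra.mem_center_iff_coeff.1 ha]
        rw [← MonoidAlgebra.mem_center_iff_coeff.1 hb q (x⁻¹ * z)]
        congr 2
        calc ((q : H) * x * (q : H)⁻¹)⁻¹ * z = q * x⁻¹ * ((q : H)⁻¹ * (z * q)) * (q : H)⁻¹ := by
              group
          _ = q * (x⁻¹ * z) * (q : H)⁻¹ := by rw [← hqz]; group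
      simp only [hmem, hfx]
    · have : x ∈ C := fun q hq => mul_inv_eq_iff_eq_mul.1 (hx ⟨q, hq⟩)
      simp [this]
  rw [Finset.sum_sub_distrib, sub_eq_zero] at hzero
  rw [hzero, ← hsub]

/-- A nilpotent central element annihilates every relative trace from the trivial subgroup. -/
theorem MonoidAlgebra.sum_coeff_conj_eq_zero [Fintype H] {b : MonoidAlgebra F H}
    (hb : b ∈ Subalgebra.center F (MonoidAlgebra F H)) (hnil : IsNilpotent b) (x y : H) :
    ∑ g : H, b.coeff (g * x * g⁻¹ * y) = 0 := by
  let A := MonoidAlgebra F H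
  let U : A →ₗ[F] A := LinearMap.mulLeft F (MonoidAlgebra.single x⁻¹ 1) *
    LinearMap.mulRight F (MonoidAlgebra.single y⁻¹ 1)
  let B : A →ₗ[F] A := LinearMap.mulLeft F b
  have hB : IsNilpotent B := LinearMap.isNilpotent_mulLeft_iff F b |>.2 hnil
  have hcomm : Commute U B := by
    refine LinearMap.ext fun u => ?_
    have hx := Subalgebra.mem_center_iff.1 hb (MonoidAlgebra.single x⁻¹ 1)
    change MonoidAlgebra.single x⁻¹ 1 * (b * u * MonoidAlgebra.single y⁻¹ 1) =
      b * (MonoidAlgebra.single x⁻¹ 1 * (u * MonoidAlgebra.single y⁻¹ 1))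
    rw [← mul_assoc b, ← hx]
    simp only [mul_assoc]
  have htr := (LinearMap.isNilpotent_trace_of_isNilpotent (hcomm.isNilpotent_mul_left hB)).eq_zero
  rw [LinearMap.trace_eq_matrix_trace F (MonoidAlgebra.basis H F), Matrix.trace] at htr
  rw [← htr, ← Equiv.sum_comp (Equiv.inv H)]
  refine Finset.sum_congr rfl fun g _ => ?_
  rw [Matrix.diag_apply, LinearMap.toMatrix_apply, MonoidAlgebra.basis_apply]
  change _ = (MonoidAlgebra.single x⁻¹ 1 *
    (b * MonoidAlgebra.single g 1 * MonoidAlgebra.single y⁻¹ 1)).coeff g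
  rw [mul_assoc b]
  have hb' := MonoidAlgebra.coeff_mul_comm_of_mem_center hb g⁻¹ (x * g * y)
  simp only [mul_assoc] at hb'
  simp [mul_assoc, hb']

/-- Central elements supported on classes of defect zero annihilate nilpotent central elements. -/
theorem MonoidAlgebra.mul_eq_zero_of_defect_zero [Fintype H] {b c : MonoidAlgebra F H}
    (hc : c ∈ Subalgebra.center F (MonoidAlgebra F H))
    (hsupp : ∀ x, c.coeff x ≠ 0 → (Nat.card (Subgroup.centralizer {x}) : F) ≠ 0)
    (hb : b ∈ Subalgebra.center F (MonoidAlgebra F H)) (hnil : IsNilpotent b) : c * b = 0 := by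
  ext y
  rw [MonoidAlgebra.coeff_mul_eq_sum]
  refine sum_eq_zero_of_sum_orbit_eq_zero (A := ConjAct H) _ fun x => ?_
  have hconst : ∀ u : MulAction.orbit (ConjAct H) x, c.coeff (u : H) = c.coeff x := by
    rintro ⟨_, g, rfl⟩
    exact MonoidAlgebra.mem_center_iff_coeff.1 hc _ _
  simp_rw [hconst, ← Finset.mul_sum]
  by_cases hx : c.coeff x = 0
  · rw [hx, zero_mul]
  have h := sum_smul_eq_card_stabilizer_mul (A := ConjAct H) (fun u => b.coeff (u⁻¹ * y)) x
  have h0 : ∑ g : ConjAct H, b.coeff ((g • x)⁻¹ * y) = 0 := by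
    rw [← MonoidAlgebra.sum_coeff_conj_eq_zero hb hnil x⁻¹ y]
    refine Fintype.sum_equiv ConjAct.ofConjAct.toEquiv _ _ fun g => ?_
    simp [ConjAct.smul_def, mul_assoc]
  rw [h0] at h
  have hne : (Nat.card (MulAction.stabilizer (ConjAct H) x) : F) ≠ 0 := by
    rw [ConjAct.stabilizer_eq_centralizer]
    exact hsupp x hx
  rw [(mul_eq_zero.1 h.symm).resolve_left hne, mul_zero]

end Center

theorem isPGroup_zpowers {H : Type*} [Group H] {p k : ℕ} {g : H} (hk : g ^ p ^ k = 1) :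
    IsPGroup p (Subgroup.zpowers g) := by
  rintro ⟨_, n, rfl⟩
  refine ⟨k, Subtype.ext ?_⟩
  change (g ^ n) ^ p ^ k = 1
  rw [← zpow_natCast, ← zpow_mul, mul_comm, zpow_mul, zpow_natCast, hk, one_zpow]

section CentralSubgroup

variable {F H : Type*} [Field F] [Group H] [Fintype H] {p : ℕ} [Fact p.Prime] [CharP F p]

theorem MonoidAlgebra.exists_coeff_ne_zero_of_coeff_mul_ne_zero {a b : MonoidAlgebra F H}
    (ha : a ∈ Subalgebra.center F (MonoidAlgebra F H))
    (hb : b ∈ Subalgebra.center F (MonoidAlgebra F H)) {Q : Subgroup H} (hQ : IsPGroup p Q)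
    {z : H} (hz : z ∈ Subgroup.centralizer (Q : Set H)) (hne : (a * b).coeff z ≠ 0) :
    ∃ x ∈ Subgroup.centralizer (Q : Set H), a.coeff x ≠ 0 := by
  rw [MonoidAlgebra.coeff_mul_eq_sum_centralizer ha hb hQ hz] at hne
  obtain ⟨x, -, hx⟩ := Finset.exists_ne_zero_of_sum_ne_zero hne
  exact ⟨x, x.2, left_ne_zero_of_mul hx⟩

/-- If `Z` is a central `p`-subgroup containing all `p`-elements that commute with `x`, then
translation by `Z` moves the conjugacy class of `x` freely. -/
theorem eq_one_of_conj_eq_mul {H : Type*} [Group H] [Finite H] {p : ℕ} [Fact p.Prime]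
    {Z : Subgroup H} (hZ : Z ≤ Subgroup.center H)
    (hp : IsPGroup p Z) {x g z : H}
    (hx : ∀ g, (∃ k, g ^ p ^ k = 1) → Commute g x → g ∈ Z) (hz : z ∈ Z)
    (h : g * x * g⁻¹ = z * x) : z = 1 := by
  have hpp : p.Prime := Fact.out
  obtain ⟨a, q, hq, hn⟩ := Nat.exists_eq_pow_mul_and_not_dvd (orderOf_pos x).ne' p hpp.ne_one
  have hxq : x ^ q ∈ Z :=
    hx _ ⟨a, by rw [← pow_mul, mul_comm, ← hn, pow_orderOf_eq_one]⟩ ((Commute.refl x).pow_left q)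
  have hcz : Commute z x := (Subgroup.mem_center_iff.1 (hZ hz) x).symm
  have h1 : (z * x) ^ q = x ^ q := by
    rw [← h, conj_pow, Subgroup.mem_center_iff.1 (hZ hxq) g, mul_inv_cancel_right]
  rw [hcz.mul_pow, mul_eq_right] at h1
  obtain ⟨k, hk⟩ := hp ⟨z, hz⟩
  have hk' : z ^ p ^ k = 1 := congrArg Subtype.val hk
  have := Nat.dvd_gcd (orderOf_dvd_of_pow_eq_one hk') (orderOf_dvd_of_pow_eq_one h1)
  rw [Nat.Coprime.gcd_eq_one ((hpp.coprime_iff_not_dvd.2 hq).pow_left k), Nat.dvd_one,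
    orderOf_eq_one_iff] at this
  exact this

theorem card_centralizer_mk_ne_zero {Z : Subgroup H} [Z.Normal] (hZ : Z ≤ Subgroup.center H)
    (hp : IsPGroup p Z) {x : H}
    (hx : ∀ g, (∃ k, g ^ p ^ k = 1) → Commute g x → g ∈ Z) :
    (Nat.card (Subgroup.centralizer {(x : H ⧸ Z)}) : F) ≠ 0 := by
  have hpp : p.Prime := Fact.out
  rw [Ne, CharP.cast_eq_zero_iff F p]
  intro hdvd
  obtain ⟨⟨q, hq⟩, hord⟩ := exists_prime_orderOf_dvd_card' p hdvd
  obtain ⟨g, rfl⟩ := QuotientGroup.mk_surjective q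
  rw [Subgroup.orderOf_mk] at hord
  have hcomm : (x : H ⧸ Z) * g = g * x := by simpa using hq x rfl
  have hz : g * x * g⁻¹ * x⁻¹ ∈ Z := by
    rw [← QuotientGroup.eq_one_iff]
    change (g : H ⧸ Z) * x * (g : H ⧸ Z)⁻¹ * (x : H ⧸ Z)⁻¹ = 1
    rw [← hcomm]
    group
  have h1 := eq_one_of_conj_eq_mul hZ hp (g := g) hx hz (by group)
  have hgx : Commute g x := by
    rw [mul_inv_eq_one, mul_inv_eq_iff_eq_mul] at h1
    exact h1
  have hgp : g ^ p ∈ Z := by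
    rw [← QuotientGroup.eq_one_iff]
    change (g : H ⧸ Z) ^ p = 1
    rw [← hord, pow_orderOf_eq_one]
  obtain ⟨k, hk⟩ := hp ⟨_, hgp⟩
  have hgZ : g ∈ Z :=
    hx g ⟨k + 1, by rw [pow_succ', pow_mul]; exact congrArg Subtype.val hk⟩ hgx
  rw [(QuotientGroup.eq_one_iff g).2 hgZ, orderOf_one] at hord
  exact hpp.ne_one hord.symm

/-- If `Z` is a central `p`-subgroup, then a `Z`-invariant central element supported on classes
with defect group `Z` annihilates every nilpotent central element. -/
theorem MonoidAlgebra.mul_eq_zero_of_translation_invariant {Z : Subgroup H}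
    (hZ : Z ≤ Subgroup.center H) (hp : IsPGroup p Z) {b c : MonoidAlgebra F H}
    (hc : c ∈ Subalgebra.center F (MonoidAlgebra F H))
    (hsupp : ∀ x, c.coeff x ≠ 0 → ∀ g, (∃ k, g ^ p ^ k = 1) → Commute g x → g ∈ Z)
    (hinv : ∀ z ∈ Z, ∀ x, c.coeff (x * z) = c.coeff x)
    (hb : b ∈ Subalgebra.center F (MonoidAlgebra F H)) (hnil : IsNilpotent b) : c * b = 0 := by
  have : Z.Normal := ⟨fun z hz g => by
    rwa [Subgroup.mem_center_iff.1 (hZ hz) g, mul_inv_cancel_right]⟩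
  let c' : MonoidAlgebra F (H ⧸ Z) :=
    .ofCoeff (Finsupp.equivFunOnFinite.symm fun q => c.coeff q.out)
  have hc'mk : ∀ x : H, c'.coeff (x : H ⧸ Z) = c.coeff x := by
    intro x
    obtain ⟨z, hz⟩ := QuotientGroup.mk_out_eq_mul Z x
    change c.coeff (Quotient.out (x : H ⧸ Z)) = _
    rw [hz, hinv z z.2]
  let π := MonoidAlgebra.mapDomainRingHom F (QuotientGroup.mk' Z)
  have hmul : ∀ (u : MonoidAlgebra F H) (y : H),
      (c * u).coeff y = (c' * π u).coeff (y : H ⧸ Z) := by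
    intro u y
    induction u using MonoidAlgebra.induction_linear with
    | zero => simp
    | add u v hu hv => simp [mul_add, hu, hv]
    | single g r =>
      have := hc'mk (y * g⁻¹)
      simp_all [π]
  have hc' : c' ∈ Subalgebra.center F (MonoidAlgebra F (H ⧸ Z)) := by
    rw [MonoidAlgebra.mem_center_iff_coeff]
    intro g x
    induction g using QuotientGroup.induction_on with | _ g
    induction x using QuotientGroup.induction_on with | _ x
    have := hc'mk (g * x * g⁻¹)
    rw [MonoidAlgebra.mem_center_iff_coeff.1 hc, ← hc'mk] at this
    exact this
  have hb' : π b ∈ Subalgebra.center F (MonoidAlgebra F (H ⧸ Z)) := by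
    rw [Subalgebra.mem_center_iff]
    intro u
    induction u using MonoidAlgebra.induction_linear with
    | zero => simp
    | add u v hu hv => rw [add_mul, mul_add, hu, hv]
    | single q r =>
      induction q using QuotientGroup.induction_on with | _ g
      have := congrArg π (Subalgebra.mem_center_iff.1 hb (MonoidAlgebra.single g r))
      simp only [map_mul, π, MonoidAlgebra.mapDomainRingHom_apply,
        MonoidAlgebra.mapDomain_single] at this
      exact this
  ext y
  rw [hmul, MonoidAlgebra.mul_eq_zero_of_defect_zero hc' _ hb' (hnil.map π)]
  · simp
  · intro q hq
    induction q using QuotientGroup.induction_on with | _ x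
    rw [hc'mk] at hq
    exact card_centralizer_mk_ne_zero hZ hp (hsupp x hq)

/-- The augmentation ideal of a group algebra. -/
noncomputable def augmentationIdeal (F A : Type*) [Field F] [CommGroup A] :
    Ideal (MonoidAlgebra F A) :=
  Ideal.span (Set.range fun z => MonoidAlgebra.single z 1 - 1)

theorem MonoidAlgebra.mul_eq_zero_of_augmentationIdeal_pow {A : Type*} [CommGroup A] {φ : A →* H}
    (hφ : φ.range ≤ Subgroup.center H) (hp : IsPGroup p φ.range)
    {N : Submodule F (MonoidAlgebra F H)}
    (hN : ∀ b ∈ N, b ∈ Subalgebra.center F (MonoidAlgebra F H)) (hnil : ∀ b ∈ N, IsNilpotent b)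
    (i : ℕ) {c : MonoidAlgebra F H}
    (hc : c ∈ Subalgebra.center F (MonoidAlgebra F H))
    (hsupp : ∀ x, c.coeff x ≠ 0 → ∀ g, (∃ k, g ^ p ^ k = 1) → Commute g x → g ∈ φ.range)
    (hkill : ∀ r ∈ augmentationIdeal F A ^ i, MonoidAlgebra.mapDomainRingHom F φ r * c = 0) :
    ∀ u ∈ N ^ i, c * u = 0 := by
  induction i generalizing c with
  | zero =>
    intro u _
    have : c = 0 := by simpa using hkill 1 (by simp)
    rw [this, zero_mul]
  | succ i ih =>
    intro v hv
    rw [pow_succ] at hv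
    induction hv using Submodule.mul_induction_on' with
    | add v _ w _ hv hw => rw [mul_add, hv, hw, add_zero]
    | mem_mul_mem u hu b hb =>
    have hucen : u ∈ Subalgebra.center F (MonoidAlgebra F H) := by
      clear ih hkill
      induction hu using Submodule.pow_induction_on_left' with
      | algebraMap r => exact Subalgebra.algebraMap_mem _ r
      | add x y i hx hy ihx ihy => exact add_mem ihx ihy
      | mem_mul m hm i x hx ihx => exact mul_mem (hN m hm) ihx
    rw [← mul_assoc]
    refine MonoidAlgebra.mul_eq_zero_of_translation_invariant hφ hp (mul_mem hc hucen) ?_ ?_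
      (hN b hb) (hnil b hb)
    · rintro x hx g ⟨k, hk⟩ hgx
      obtain ⟨y, hy, hcy⟩ := MonoidAlgebra.exists_coeff_ne_zero_of_coeff_mul_ne_zero hc hucen
        (isPGroup_zpowers hk)
        (z := x) (by rwa [Subgroup.zpowers_eq_closure, Subgroup.centralizer_closure,
          Subgroup.mem_centralizer_singleton_iff, eq_comm]) hx
      refine hsupp y hcy g ⟨k, hk⟩ (hy g (Subgroup.mem_zpowers g))
    · rintro _ ⟨z, rfl⟩ x
      have hz : φ z ∈ Subgroup.center H := hφ ⟨z, rfl⟩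
      have hs : MonoidAlgebra.single (φ z)⁻¹ 1 - 1 ∈ Subalgebra.center F (MonoidAlgebra F H) := by
        refine sub_mem (Subalgebra.mem_center_iff.2 fun w => ?_) (one_mem _)
        exact (MonoidAlgebra.single_commute
          (fun g => (Subgroup.mem_center_iff.1 (inv_mem hz) g).symm)
          (fun r => Commute.all _ r) w).symm
      have h0 : (MonoidAlgebra.single (φ z)⁻¹ 1 - 1) * c * u = 0 := by
        refine ih (mul_mem hs hc) ?_ ?_ u hu
        · intro y hy g hg hgy
          by_cases hcy : c.coeff y = 0
          · refine hsupp (φ z * y) (fun h => hy ?_) g hg ?_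
            · simp [sub_mul, h, hcy]
            · exact Commute.mul_right (Subgroup.mem_center_iff.1 hz g) hgy
          · exact hsupp y hcy g hg hgy
        · intro r hr
          have hmem : r * (MonoidAlgebra.single z⁻¹ 1 - 1) ∈ augmentationIdeal F A ^ (i + 1) :=
            Ideal.mul_mem_mul hr (Ideal.subset_span ⟨z⁻¹, rfl⟩)
          have := hkill _ hmem
          rw [map_mul, map_sub, map_one, mul_assoc] at this
          simpa only [MonoidAlgebra.mapDomainRingHom_apply, MonoidAlgebra.mapDomain_single,
            map_inv] using this
      have := congrArg (fun w => w.coeff x) h0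
      rw [mul_assoc] at this
      simp only [sub_mul, one_mul, MonoidAlgebra.coeff_sub, Finsupp.sub_apply,
        MonoidAlgebra.coeff_single_mul_apply, inv_inv, MonoidAlgebra.coeff_zero,
        Finsupp.zero_apply, sub_eq_zero] at this
      rw [Subgroup.mem_center_iff.1 hz x]
      exact this

end CentralSubgroup

section LoewyBound

/-- The largest Loewy length of `FA` for an abelian group `A` of order `p ^ n` whose exponent
divides `p ^ m`. -/
def abelianLoewyBound (p m n : ℕ) : ℕ := n / m * (p ^ m - 1) + p ^ (n % m)

theorem abelianLoewyBound_add_le {p m a : ℕ} (hp : 0 < p) (hm : 0 < m) (ha : a ≤ m) (n : ℕ) :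
    abelianLoewyBound p m n + (p ^ a - 1) ≤ abelianLoewyBound p m (n + a) := by
  unfold abelianLoewyBound
  have hs := Nat.mod_lt n hm
  have hn := Nat.div_add_mod n m
  set q := n / m
  set s := n % m
  clear_value q s
  rcases lt_or_ge (s + a) m with h | h
  · have h1 : (n + a) / m = q := by
      rw [← hn, add_assoc, Nat.mul_add_div hm, Nat.div_eq_of_lt h, add_zero]
    have h2 : (n + a) % m = s + a := by
      rw [← hn, add_assoc, Nat.mul_add_mod, Nat.mod_eq_of_lt h]
    rw [h1, h2, pow_add]
    obtain ⟨u, hu⟩ := Nat.exists_eq_add_of_le' (Nat.pow_pos hp : 1 ≤ p ^ s)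
    obtain ⟨v, hv⟩ := Nat.exists_eq_add_of_le' (Nat.pow_pos hp : 1 ≤ p ^ a)
    rw [hu, hv, Nat.add_sub_cancel]
    nlinarith [Nat.zero_le (u * v)]
  · obtain ⟨t, ht⟩ := Nat.exists_eq_add_of_le h
    have htm : t < m := by omega
    obtain ⟨b, rfl⟩ : ∃ b, s = t + b := Nat.exists_eq_add_of_le (by omega)
    obtain ⟨c, rfl⟩ : ∃ c, a = t + c := Nat.exists_eq_add_of_le (by omega)
    have hmt : m = t + b + c := by omega
    have h1 : (n + (t + c)) / m = q + 1 := by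
      rw [← hn, add_assoc, Nat.mul_add_div hm, ht, Nat.add_div_left _ hm, Nat.div_eq_of_lt htm]
    have h2 : (n + (t + c)) % m = t := by
      rw [← hn, add_assoc, Nat.mul_add_mod, ht, Nat.add_mod_left, Nat.mod_eq_of_lt htm]
    rw [h1, h2, add_mul, one_mul]
    have key : p ^ (t + b) + (p ^ (t + c) - 1) ≤ (p ^ m - 1) + p ^ t := by
      rw [hmt, pow_add p (t + b) c, pow_add p t b, pow_add p t c]
      have hx : 1 ≤ p ^ t := Nat.pow_pos hp
      obtain ⟨u, hu⟩ := Nat.exists_eq_add_of_le' (Nat.pow_pos hp : 1 ≤ p ^ b)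
      obtain ⟨v, hv⟩ := Nat.exists_eq_add_of_le' (Nat.pow_pos hp : 1 ≤ p ^ c)
      rw [hu, hv]
      generalize p ^ t = x at *
      have h3 : 1 ≤ x * (v + 1) := Nat.mul_pos hx v.succ_pos
      have h4 : 1 ≤ x * (u + 1) * (v + 1) := Nat.mul_pos (Nat.mul_pos hx u.succ_pos) v.succ_pos
      zify [h3, h4]
      nlinarith [mul_nonneg (mul_nonneg (Int.natCast_nonneg x) (Int.natCast_nonneg u))
        (Int.natCast_nonneg v)]
    omega

theorem abelianLoewyBound_monotone {p m : ℕ} (hp : 0 < p) (hm : 0 < m) :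
    Monotone (abelianLoewyBound p m) :=
  monotone_nat_of_le_succ fun n =>
    le_self_add.trans (abelianLoewyBound_add_le hp hm (a := 1) hm n)

theorem sum_abelianLoewyBound {p m : ℕ} (hp : 2 ≤ p) (hm : 0 < m) (k : ℕ) :
    ∑ n ∈ Finset.range (k * m), abelianLoewyBound p m n =
      m * (p ^ m - 1) * (∑ j ∈ Finset.range k, j) + k * ((p ^ m - 1) / (p - 1)) := by
  induction k with
  | zero => simp
  | succ k ih =>
    have h : ∀ s ∈ Finset.range m, abelianLoewyBound p m (k * m + s) = k * (p ^ m - 1) + p ^ s := by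
      intro s hs
      have hs' := Finset.mem_range.1 hs
      rw [abelianLoewyBound, mul_comm k, Nat.mul_add_div hm, Nat.div_eq_of_lt hs', add_zero,
        Nat.mul_add_mod, Nat.mod_eq_of_lt hs']
    rw [add_mul, one_mul, Finset.sum_range_add, ih, Finset.sum_congr rfl h,
      Finset.sum_add_distrib, Finset.sum_const, Finset.card_range, Nat.geomSum_eq hp,
      Finset.sum_range_succ, smul_eq_mul]
    ring

theorem sum_abelianLoewyBound_le {p m d : ℕ} (hp : 2 ≤ p) (hm : 0 < m) :
    ∑ n ∈ Finset.range (d + 1), abelianLoewyBound p m n ≤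
      m * (p ^ m - 1) * (d / m * (d / m + 1) / 2) + (d / m + 1) * ((p ^ m - 1) / (p - 1)) := by
  have h := sum_abelianLoewyBound hp hm (d / m + 1)
  rw [Finset.sum_range_id, Nat.add_sub_cancel, mul_comm (d / m + 1) (d / m)] at h
  rw [← h]
  refine Finset.sum_le_sum_of_subset (Finset.range_mono ?_)
  rw [mul_comm]
  exact Nat.lt_mul_div_succ d hm

theorem sum_add_one_le_abelianLoewyBound {p m : ℕ} (hp : 0 < p) (hm : 0 < m) {ι : Type*}
    (s : Finset ι) (a : ι → ℕ) (ha : ∀ i, a i ≤ m) :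
    ∑ i ∈ s, (p ^ a i - 1) + 1 ≤ abelianLoewyBound p m (∑ i ∈ s, a i) := by
  induction s using Finset.induction_on with
  | empty => simp [abelianLoewyBound]
  | insert i s his ih =>
    rw [Finset.sum_insert his, Finset.sum_insert his, add_comm (a i)]
    have := abelianLoewyBound_add_le hp hm (ha i) (∑ i ∈ s, a i)
    omega

theorem Finset.sum_pow_eq_zero_of_pow_eq_zero {R ι : Type*} [CommSemiring R] (s : Finset ι)
    (x : ι → R) (b : ι → ℕ) (hx : ∀ i, x i ^ (b i + 1) = 0) :
    (∑ i ∈ s, x i) ^ (∑ i ∈ s, b i + 1) = 0 := by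
  induction s using Finset.induction_on with
  | empty => simp
  | insert i s his ih =>
    rw [Finset.sum_insert his, Finset.sum_insert his]
    exact (Commute.all _ _).add_pow_eq_zero_of_add_le_succ_of_pow_eq_zero (hx i) ih (by omega)

theorem augmentationIdeal_pow_eq_bot {F A : Type*} [Field F] [CommGroup A] [Finite A] {p m r : ℕ}
    [Fact p.Prime] [CharP F p] (hm : 0 < m) (hcard : Nat.card A = p ^ r)
    (hexp : ∀ a : A, a ^ p ^ m = 1) :
    augmentationIdeal F A ^ abelianLoewyBound p m r = ⊥ := by
  have hpp : p.Prime := Fact.out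
  obtain ⟨ι, _, n, hn, ⟨e⟩⟩ := CommGroup.equiv_prod_multiplicative_zmod_of_finite A
  let g : ∀ i, Multiplicative (ZMod (n i)) →* A := fun i =>
    e.symm.toMonoidHom.comp (MonoidHom.mulSingle (fun i => Multiplicative (ZMod (n i))) i)
  have hgen : ∀ i, n i ∣ p ^ m := by
    intro i
    have hinj : Function.Injective (g i) := by
      refine e.symm.injective.comp ?_
      exact Pi.mulSingle_injective (M := fun i => Multiplicative (ZMod (n i))) i
    have h : Multiplicative.ofAdd (1 : ZMod (n i)) ^ p ^ m = 1 :=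
      hinj (by rw [map_pow, hexp, map_one])
    rw [← ofAdd_nsmul, nsmul_one] at h
    exact (ZMod.natCast_eq_zero_iff _ _).1 h
  choose a ha hna using fun i => (Nat.dvd_prime_pow hpp).1 (hgen i)
  have hsum : ∑ i, a i = r := by
    have : Nat.card A = p ^ ∑ i, a i := by
      rw [Nat.card_congr e.toEquiv, Nat.card_pi, ← Finset.prod_pow_eq_pow_sum]
      refine Finset.prod_congr rfl fun i _ => ?_
      rw [← hna]
      exact Nat.card_zmod (n i)
    exact Nat.pow_right_injective hpp.two_le (this.symm.trans hcard)
  have hchar : CharP (MonoidAlgebra F A) p :=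
    charP_of_injective_algebraMap (algebraMap F (MonoidAlgebra F A)).injective p
  let x : ι → MonoidAlgebra F A := fun i =>
    MonoidAlgebra.single (g i (Multiplicative.ofAdd 1)) 1 - 1
  have hx : ∀ i, Ideal.span {x i} ^ (p ^ a i - 1 + 1) = (0 : Ideal (MonoidAlgebra F A)) := by
    intro i
    rw [Nat.sub_add_cancel (Nat.pow_pos hpp.pos), Ideal.span_singleton_pow, Ideal.zero_eq_bot,
      Ideal.span_singleton_eq_bot, sub_pow_char_pow, MonoidAlgebra.single_pow, ← hna, ← map_pow,
      ← ofAdd_nsmul]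
    simp [MonoidAlgebra.one_def]
  have hle : augmentationIdeal F A ≤ ∑ i, Ideal.span {x i} := by
    set K := ∑ i, Ideal.span {x i}
    have hmul : ∀ z w : A, MonoidAlgebra.single z 1 - 1 ∈ K → MonoidAlgebra.single w 1 - 1 ∈ K →
        MonoidAlgebra.single (z * w) 1 - 1 ∈ K := by
      intro z w hz hw
      have : (MonoidAlgebra.single (z * w) 1 - 1 : MonoidAlgebra F A) =
          MonoidAlgebra.single z 1 * (MonoidAlgebra.single w 1 - 1) +
            (MonoidAlgebra.single z 1 - 1) := by
        rw [mul_sub, MonoidAlgebra.single_mul_single]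
        simp
      rw [this]
      exact add_mem (K.mul_mem_left _ hw) hz
    let S : Submonoid A :=
      { carrier := {z | MonoidAlgebra.single z 1 - 1 ∈ K}
        one_mem' := by simp [MonoidAlgebra.one_def]
        mul_mem' := fun {z w} hz hw => hmul z w hz hw }
    have hS : ∀ i y, g i y ∈ S := by
      intro i y
      have h1 : g i (Multiplicative.ofAdd 1) ∈ S :=
        (Finset.single_le_sum (f := fun i => Ideal.span {x i}) (fun _ _ => bot_le)
          (Finset.mem_univ i)) (Ideal.mem_span_singleton_self _)
      have : NeZero (n i) := ⟨by have := hn i; omega⟩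
      have hy : y = Multiplicative.ofAdd (1 : ZMod (n i)) ^ (y.toAdd).val := by
        rw [← ofAdd_nsmul]
        simp
      rw [hy, map_pow]
      exact pow_mem h1 _
    refine Ideal.span_le.2 ?_
    rintro _ ⟨z, rfl⟩
    change z ∈ S
    have hz : z = ∏ i, g i (e z i) := by
      apply e.injective
      rw [map_prod]
      simp [g, Finset.univ_prod_mulSingle]
    rw [hz]
    exact prod_mem fun i _ => hS i _
  rw [← le_bot_iff, ← hsum]
  calc _ ≤ augmentationIdeal F A ^ (∑ i, (p ^ a i - 1) + 1) :=
        Ideal.pow_le_pow_right (sum_add_one_le_abelianLoewyBound hpp.pos hm _ a ha)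
    _ ≤ (∑ i, Ideal.span {x i}) ^ (∑ i, (p ^ a i - 1) + 1) := Ideal.pow_right_mono hle _
    _ ≤ ⊥ := (Finset.sum_pow_eq_zero_of_pow_eq_zero _ _ _ hx).le

end LoewyBound

theorem mem_centralizer_iff_le_centralizer_singleton {G : Type*} [Group G] {x : G}
    {P : Subgroup G} :
    x ∈ Subgroup.centralizer (P : Set G) ↔ P ≤ Subgroup.centralizer {x} := by
  simp [Subgroup.mem_centralizer_iff, SetLike.le_def, eq_comm]

section BrauerMap

variable {F G : Type*} [Field F] [Group G] [Fintype G] {p : ℕ} [Fact p.Prime] [CharP F p]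

/-- The Brauer homomorphism `Z(FG) → F C_G(Q)`, restricting coefficients to the centralizer of the
`p`-subgroup `Q`. -/
noncomputable def brauerMap {Q : Subgroup G} (hQ : IsPGroup p Q) :
    Subalgebra.center F (MonoidAlgebra F G) →ₐ[F]
      MonoidAlgebra F (Subgroup.centralizer (Q : Set G)) :=
  AlgHom.ofLinearMap
    { toFun := fun a => .ofCoeff (Finsupp.equivFunOnFinite.symm fun x =>
        (a : MonoidAlgebra F G).coeff x)
      map_add' := fun a b => by ext x; simp
      map_smul' := fun r a => by ext x; simp }
    (by
      ext x
      simp [MonoidAlgebra.one_def, Finsupp.single_apply, eq_comm])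
    (fun a b => by
      ext x
      rw [MonoidAlgebra.coeff_mul_eq_sum]
      exact MonoidAlgebra.coeff_mul_eq_sum_centralizer a.2 b.2 hQ x.2)

theorem coeff_brauerMap {Q : Subgroup G} (hQ : IsPGroup p Q)
    (a : Subalgebra.center F (MonoidAlgebra F G)) (x : Subgroup.centralizer (Q : Set G)) :
    (brauerMap hQ a).coeff x = (a : MonoidAlgebra F G).coeff x := rfl

theorem brauerMap_mem_center {Q : Subgroup G} (hQ : IsPGroup p Q)
    (a : Subalgebra.center F (MonoidAlgebra F G)) :
    brauerMap hQ a ∈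
      Subalgebra.center F (MonoidAlgebra F (Subgroup.centralizer (Q : Set G))) := by
  rw [MonoidAlgebra.mem_center_iff_coeff]
  exact fun g x => MonoidAlgebra.mem_center_iff_coeff.1 a.2 g x

/-- If `Q` is a maximal `p`-subgroup centralizing elements of the support of `a`, then the Brauer
map at `Q` sends the product of `a` with many elements of a nil subspace to zero. -/
theorem brauerMap_mul_eq_zero {Q : Subgroup G} (hQ : IsPGroup p Q) {m r : ℕ} (hm : 0 < m)
    (hcard : Nat.card Q = p ^ r) (hexp : ∀ q ∈ Q, q ^ p ^ m = 1)
    {N : Submodule F (Subalgebra.center F (MonoidAlgebra F G))} (hN : ∀ b ∈ N, IsNilpotent b)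
    {a : Subalgebra.center F (MonoidAlgebra F G)}
    (hmax : ∀ z, (a : MonoidAlgebra F G).coeff z ≠ 0 → ∀ P : Subgroup G, IsPGroup p P →
      z ∈ Subgroup.centralizer (P : Set G) → Q ≤ P → P = Q)
    {u : Subalgebra.center F (MonoidAlgebra F G)} (hu : u ∈ N ^ abelianLoewyBound p m r) :
    brauerMap hQ (a * u) = 0 := by
  set C := Subgroup.centralizer (Q : Set G)
  let A : Subgroup C := Q.subgroupOf C
  have hA : A ≤ Subgroup.center C := fun g hg => Subgroup.mem_center_iff.2 fun x =>
    Subtype.ext (x.2 g hg).symm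
  let _ : CommGroup A :=
    { (inferInstance : Group A) with
      mul_comm := fun x y => Subtype.ext (Subgroup.mem_center_iff.1 (hA y.2) x) }
  have hAp : IsPGroup p A := hQ.comap_of_injective C.subtype C.subtype_injective
  have hr : A.subtype.range = A := A.range_subtype
  obtain ⟨k, hk⟩ := IsPGroup.iff_card.1 hAp
  have hkr : k ≤ r := by
    have h : Nat.card A ≤ Nat.card Q :=
      Nat.card_le_card_of_injective (fun y : A => (⟨y.1.1, y.2⟩ : Q)) fun x y h =>
        Subtype.ext (Subtype.ext (congrArg (fun q : Q => (q : G)) h))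
    rw [hk, hcard] at h
    exact (Nat.pow_le_pow_iff_right (Fact.out : p.Prime).one_lt).1 h
  have haug : augmentationIdeal F A ^ abelianLoewyBound p m r = ⊥ := by
    rw [eq_bot_iff, ← augmentationIdeal_pow_eq_bot (F := F) hm hk fun y =>
      Subtype.ext (Subtype.ext (hexp y.1.1 y.2))]
    exact Ideal.pow_le_pow_right (abelianLoewyBound_monotone (Fact.out : p.Prime).pos hm hkr)
  rw [map_mul]
  refine MonoidAlgebra.mul_eq_zero_of_augmentationIdeal_pow (φ := A.subtype) (p := p)
    (N := N.map (brauerMap hQ).toLinearMap) (hr.le.trans hA) (hr.symm ▸ hAp) ?_ ?_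
    (abelianLoewyBound p m r) (brauerMap_mem_center hQ a) ?_ ?_ _ ?_
  · rintro _ ⟨b, -, rfl⟩
    exact brauerMap_mem_center hQ b
  · rintro _ ⟨b, hb, rfl⟩
    exact (hN b hb).map (brauerMap hQ)
  · rintro x hx g ⟨l, hl⟩ hgx
    rw [hr]
    have hP : IsPGroup p ↥(Q ⊔ Subgroup.zpowers (g : G)) := by
      refine hQ.to_sup_of_normal_left' (isPGroup_zpowers (k := l) (congrArg Subtype.val hl)) ?_
      rw [Subgroup.zpowers_le]
      exact Subgroup.centralizer_le_normalizer _ g.2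
    have hx' : (x : G) ∈
        Subgroup.centralizer ((Q ⊔ Subgroup.zpowers (g : G) : Subgroup G) : Set G) := by
      rw [mem_centralizer_iff_le_centralizer_singleton]
      refine sup_le (mem_centralizer_iff_le_centralizer_singleton.1 x.2) ?_
      rw [Subgroup.zpowers_le, Subgroup.mem_centralizer_singleton_iff]
      exact congrArg Subtype.val hgx
    have := hmax x hx _ hP hx' le_sup_left
    exact this.le (Subgroup.mem_sup_right (Subgroup.mem_zpowers (g : G)))
  · intro s hs
    rw [haug, Ideal.mem_bot] at hs
    rw [hs, map_zero, zero_mul]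
  · rw [← Submodule.map_pow]
    exact Submodule.mem_map_of_mem hu
end BrauerMap

section Filtration

variable {F G : Type*} [Field F] [Group G]

/-- The elements of `FG` such that all `p`-subgroups centralizing an element of the support have
order less than `p ^ n` and exponent dividing `p ^ m`. -/
def defectLT (F G : Type*) [Field F] [Group G] (p n m : ℕ) : Submodule F (MonoidAlgebra F G) where
  carrier := {a | ∀ z, a.coeff z ≠ 0 → ∀ Q : Subgroup G, IsPGroup p Q →
    z ∈ Subgroup.centralizer (Q : Set G) → Nat.card Q < p ^ n ∧ ∀ q ∈ Q, q ^ p ^ m = 1}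
  zero_mem' := fun z hz => absurd rfl hz
  add_mem' := fun {a b} ha hb z hz => by
    by_cases h : a.coeff z = 0
    · exact hb z fun h' => hz (by simp [h, h'])
    · exact ha z h
  smul_mem' := fun r a ha z hz => ha z fun h => hz (by simp [h])

theorem eq_zero_of_mem_defectLT_zero {p m : ℕ} {a : MonoidAlgebra F G}
    (ha : a ∈ defectLT F G p 0 m) : a = 0 := by
  ext z
  by_contra hz
  have := (ha z hz ⊥ IsPGroup.of_bot (by simp [Subgroup.mem_centralizer_iff])).1
  simp at this

variable [Fintype G] {p : ℕ} [Fact p.Prime] [CharP F p]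

theorem mul_mem_defectLT {m n : ℕ} (hm : 0 < m)
    {N : Submodule F (Subalgebra.center F (MonoidAlgebra F G))} (hN : ∀ b ∈ N, IsNilpotent b)
    {a u : Subalgebra.center F (MonoidAlgebra F G)}
    (ha : (a : MonoidAlgebra F G) ∈ defectLT F G p (n + 1) m)
    (hu : u ∈ N ^ abelianLoewyBound p m n) :
    ((a * u : Subalgebra.center F (MonoidAlgebra F G)) : MonoidAlgebra F G) ∈
      defectLT F G p n m := by
  intro z hz Q hQ hzQ
  have hpp : p.Prime := Fact.out
  obtain ⟨x, hx, hax⟩ := MonoidAlgebra.exists_coeff_ne_zero_of_coeff_mul_ne_zero a.2 u.2 hQ hzQ hz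
  obtain ⟨hlt, hexp⟩ := ha x hax Q hQ hx
  refine ⟨?_, hexp⟩
  obtain ⟨k, hk⟩ := IsPGroup.iff_card.1 hQ
  rw [hk, Nat.pow_lt_pow_iff_right hpp.one_lt] at hlt ⊢
  refine lt_of_le_of_ne (Nat.lt_succ_iff.1 hlt) ?_
  rintro rfl
  refine hz ?_
  have h0 := brauerMap_mul_eq_zero hQ hm hk hexp hN (a := a) (fun y hy P hP hyP hQP => ?_) hu
  · rw [← coeff_brauerMap hQ (a * u) ⟨z, hzQ⟩, h0]
    rfl
  · obtain ⟨l, hl⟩ := IsPGroup.iff_card.1 hP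
    have h := (ha y hy P hP hyP).1
    rw [hl, Nat.pow_lt_pow_iff_right hpp.one_lt] at h
    refine (Subgroup.eq_of_le_of_card_ge hQP ?_).symm
    rw [hk, hl]
    exact Nat.pow_le_pow_right hpp.pos (Nat.lt_succ_iff.1 h)

theorem mul_eq_zero_of_mem_defectLT {m : ℕ} (hm : 0 < m)
    {N : Submodule F (Subalgebra.center F (MonoidAlgebra F G))} (hN : ∀ b ∈ N, IsNilpotent b)
    (n : ℕ) {a u : Subalgebra.center F (MonoidAlgebra F G)}
    (ha : (a : MonoidAlgebra F G) ∈ defectLT F G p n m)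
    (hu : u ∈ N ^ ∑ i ∈ Finset.range n, abelianLoewyBound p m i) : a * u = 0 := by
  induction n generalizing a u with
  | zero => rw [show a = 0 from Subtype.ext (eq_zero_of_mem_defectLT_zero ha), zero_mul]
  | succ n ih =>
    rw [Finset.sum_range_succ, add_comm, pow_add] at hu
    induction hu using Submodule.mul_induction_on' with
    | add v _ w _ hv hw => rw [mul_add, hv, hw, add_zero]
    | mem_mul_mem v hv w hw =>
      rw [← mul_assoc]
      exact ih (mul_mem_defectLT hm hN ha hv) hw

end Filtration

theorem exists_conj_mem_of_isClassDefectGroup {G : Type} [Group G] [Finite G] {p : ℕ}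
    [Fact p.Prime] {P Q : Subgroup G} {K : ConjClasses G} (hP : IsClassDefectGroup p P K)
    (hQ : IsPGroup p Q) {z : G} (hz : z ∈ K.carrier)
    (hzQ : z ∈ Subgroup.centralizer (Q : Set G)) : ∃ g : G, ∀ q ∈ Q, g * q * g⁻¹ ∈ P := by
  obtain ⟨x, hx, S, rfl⟩ := hP
  rw [ConjClasses.mem_carrier_iff_mk_eq] at hx hz
  obtain ⟨c, hc⟩ := isConj_iff.1 (ConjClasses.mk_eq_mk_iff_isConj.1 (hz.trans hx.symm))
  let C := Subgroup.centralizer {x}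
  let R : Subgroup C := (Q.map (MulAut.conj c).toMonoidHom).subgroupOf C
  have hR : IsPGroup p R := (hQ.map _).comap_of_injective _ C.subtype_injective
  obtain ⟨T, hT⟩ := hR.exists_le_sylow
  obtain ⟨h, hh⟩ := MulAction.exists_smul_eq C T S
  refine ⟨h * c, fun q hq => ?_⟩
  have hqC : c * q * c⁻¹ ∈ C := by
    rw [Subgroup.mem_centralizer_singleton_iff, ← hc]
    have := hzQ q hq
    calc _ = c * (q * z) * c⁻¹ := by group
      _ = c * (z * q) * c⁻¹ := by rw [this]
      _ = _ := by group
  have h1 : (⟨_, hqC⟩ : C) ∈ T := hT ⟨q, hq, rfl⟩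
  have h2 : h * ⟨_, hqC⟩ * h⁻¹ ∈ S := by
    rw [← hh]
    exact Subgroup.smul_mem_pointwise_smul _ (MulAut.conj h) T.toSubgroup h1
  refine ⟨_, h2, ?_⟩
  simp [mul_assoc]

theorem classIdealLE_le_defectLT (F : Type) [Field F] {G : Type} [Group G] [Fintype G] {p d m : ℕ}
    [Fact p.Prime] {D : Subgroup G} (hcard : Nat.card D = p ^ d)
    (hexp : Monoid.exponent D = p ^ m) :
    classIdealLE F p D ≤ defectLT F G p (d + 1) m := by
  refine iSup₂_le fun P hPD => Submodule.span_le.2 ?_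
  rintro _ ⟨K, hK, rfl⟩ z hz Q hQ hzQ
  have hzK : z ∈ K.carrier := by
    by_contra h
    refine hz ?_
    rw [classSum, MonoidAlgebra.coeff_sum, Finsupp.finsetSum_apply]
    refine Finset.sum_eq_zero fun x _ => ?_
    split_ifs with hx
    · rw [MonoidAlgebra.coeff_single, Finsupp.single_apply, if_neg]
      rintro rfl
      exact h hx
    · rfl
  obtain ⟨g, hg⟩ := exists_conj_mem_of_isClassDefectGroup hK hQ hzK hzQ
  constructor
  · refine lt_of_le_of_lt ?_ (Nat.pow_lt_pow_succ (Fact.out : p.Prime).one_lt)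
    rw [← hcard]
    refine Nat.card_le_card_of_injective
      (fun q : Q => (⟨g * q * g⁻¹, hPD (hg q q.2)⟩ : D)) fun a b h => Subtype.ext ?_
    simpa using congrArg Subtype.val h
  · intro q hq
    have h := Monoid.pow_exponent_eq_one (⟨g * q * g⁻¹, hPD (hg q hq)⟩ : D)
    rw [hexp] at h
    have h' : (g * q * g⁻¹) ^ p ^ m = 1 := congrArg Subtype.val h
    rw [conj_pow] at h'
    simpa using h'

/-- If `D` is a `p`-subgroup of `G` with `|D| = p^d > 1` and exponent `p^m`, `α = ⌊d/m⌋`, and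
`N = m(p^m-1)·α(α+1)/2 + (α+1)·(p^m-1)/(p-1)`, then every central idempotent `e` of `FG` lying
in `I_{≤D}(G)` satisfies `e · J(Z(FG))^N = 0`. -/
theorem stmt6 (F : Type) [Field F] [IsAlgClosed F] (G : Type) [Group G] [Fintype G]
    (p : ℕ) [Fact p.Prime] [CharP F p]
    (D : Subgroup G) (hD : IsPGroup p D) (d m : ℕ) (hcard : Fintype.card ↥D = p ^ d)
    (hd : 1 ≤ d) (hexp : Monoid.exponent ↥D = p ^ m)
    (α N : ℕ) (hα : α = d / m)
    (hN : N = m * (p ^ m - 1) * (α * (α + 1) / 2) + (α + 1) * ((p ^ m - 1) / (p - 1)))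
    (e : MonoidAlgebra F G) (hcentral : e ∈ Subalgebra.center F (MonoidAlgebra F G))
    (hidem : IsIdempotentElem e) (hmem : e ∈ classIdealLE F p D) :
    ∀ x ∈ (JZ F G) ^ N, e * x = 0 := by
  have hpp : p.Prime := Fact.out
  rw [Fintype.card_eq_nat_card] at hcard
  have hm : 0 < m := by
    refine Nat.pos_of_ne_zero ?_
    rintro rfl
    rw [pow_zero, Monoid.exp_eq_one_iff] at hexp
    rw [Nat.card_of_subsingleton (1 : D)] at hcard
    exact (Nat.one_lt_pow (by omega) hpp.one_lt).ne hcard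
  have : IsArtinianRing (Subalgebra.center F (MonoidAlgebra F G)) :=
    IsArtinianRing.of_finite F _
  have hnil : ∀ b ∈ (Ideal.jacobson
      (⊥ : Ideal (Subalgebra.center F (MonoidAlgebra F G)))).restrictScalars F,
      IsNilpotent b := by
    intro b hb
    obtain ⟨k, hk⟩ := IsArtinianRing.isNilpotent_jacobson_bot
      (R := Subalgebra.center F (MonoidAlgebra F G))
    refine ⟨k, ?_⟩
    have := Ideal.pow_mem_pow hb k
    rwa [hk] at this
  intro x hx
  rw [JZ, ← Submodule.map_pow] at hx
  obtain ⟨u, hu, rfl⟩ := hx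
  have hle := sum_abelianLoewyBound_le (d := d) hpp.two_le hm
  rw [← hα, ← hN] at hle
  have hu' : (⟨e, hcentral⟩ : Subalgebra.center F (MonoidAlgebra F G)) * u = 0 := by
    obtain ⟨t, rfl⟩ := Nat.exists_eq_add_of_le hle
    clear hN
    rw [pow_add] at hu
    induction hu using Submodule.mul_induction_on' with
    | add v _ w _ hv hw => rw [mul_add, hv, hw, add_zero]
    | mem_mul_mem v hv w hw =>
      rw [← mul_assoc, mul_eq_zero_of_mem_defectLT hm hnil (d + 1)
        (classIdealLE_le_defectLT F hcard hexp hmem) hv, zero_mul]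
  exact congrArg Subtype.val hu'
end

section
/- Let P be a central p-subgroup of the finite group G and let K be a conjugacy class of G having P as a defect group. Then the p-part u of any element x ∈ K lies in P, every element of K has the same p-part u, and the set K' := u^{−1}K = {u^{−1}y : y ∈ K} is a p-regular conjugacy class of G (all its elements have order prime to p) which also has P as a defect group. -/
set_option synthInstance.maxHeartbeats 1000000
set_option maxHeartbeats 1000000

open scoped Classical

/-- A `p`-element commuting with an element of a class lies in any central defect group of the
class. -/
theorem IsClassDefectGroup.mem_of_commute {G : Type} [Group G] {p : ℕ}
    {P : Subgroup G} {K : ConjClasses G} (hK : IsClassDefectGroup p P K)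
    (hcentral : P ≤ Subgroup.center G) {y v : G} (hy : y ∈ K.carrier) (hvy : Commute v y)
    (hv : ∃ k : ℕ, orderOf v = p ^ k) : v ∈ P := by
  obtain ⟨x, hx, S, rfl⟩ := hK
  rw [ConjClasses.mem_carrier_iff_mk_eq] at hx hy
  obtain ⟨g, rfl⟩ := isConj_iff.1 (ConjClasses.mk_eq_mk_iff_isConj.1 (hx.trans hy.symm))
  obtain ⟨k, hk⟩ := hv
  have hcomm : Commute (g⁻¹ * v * g) x := by
    have h := hvy.eq
    calc g⁻¹ * v * g * x = g⁻¹ * (v * (g * x * g⁻¹)) * g := by group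
      _ = g⁻¹ * ((g * x * g⁻¹) * v) * g := by rw [h]
      _ = x * (g⁻¹ * v * g) := by group
  have hpow : (g⁻¹ * v * g) ^ p ^ k = 1 := by
    have h := conj_pow (i := p ^ k) (a := g⁻¹) (b := v)
    rw [inv_inv, ← hk, pow_orderOf_eq_one] at h
    rw [← hk, h]
    group
  let c : Subgroup.centralizer {x} :=
    ⟨g⁻¹ * v * g, Subgroup.mem_centralizer_singleton_iff.2 hcomm.eq⟩
  have hSnormal : (S : Subgroup (Subgroup.centralizer {x})).Normal := by
    refine ⟨fun a ha b => ?_⟩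
    have hac := Subgroup.mem_center_iff.1 (hcentral (Subgroup.mem_map_of_mem _ ha)) b
    have hab : b * a = a * b := Subtype.ext hac
    rwa [hab, mul_inv_cancel_right]
  have hc : IsPGroup p (Subgroup.zpowers c) := by
    rintro ⟨_, n, rfl⟩
    refine ⟨k, Subtype.ext (Subtype.ext ?_)⟩
    change (((g⁻¹ * v * g) ^ n) ^ p ^ k : G) = 1
    rw [← zpow_natCast, zpow_comm, zpow_natCast, hpow, one_zpow]
  have hcS : c ∈ (S : Subgroup (Subgroup.centralizer {x})) := by
    have h := S.is_maximal' (hc.to_sup_of_normal_right S.isPGroup') le_sup_right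
    exact h.le (Subgroup.mem_sup_left (Subgroup.mem_zpowers c))
  have hmem : g⁻¹ * v * g ∈ S.toSubgroup.map (Subgroup.centralizer {x}).subtype :=
    Subgroup.mem_map_of_mem _ hcS
  have hg := Subgroup.mem_center_iff.1 (hcentral hmem) g
  have hv : v = g⁻¹ * v * g := by
    have : g⁻¹ * v * g * g = v * g := by rw [← hg]; group
    exact (mul_right_cancel this).symm
  rwa [hv]

/-- If two factorizations into a central `p`-element and a `p'`-element agree, so do their
`p`-parts. -/
theorem eq_of_central_mul_eq_mul {G : Type} [Group G] {p : ℕ} [Fact p.Prime] {u v s w : G}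
    (huc : u ∈ Subgroup.center G) (hvc : v ∈ Subgroup.center G)
    (hu : ∃ k : ℕ, orderOf u = p ^ k) (hv : ∃ k : ℕ, orderOf v = p ^ k)
    (hs : ¬ p ∣ orderOf s) (hw : ¬ p ∣ orderOf w) (h : v * w = u * s) : v = u := by
  have hp : p.Prime := Fact.out
  obtain ⟨k, hk⟩ := hu
  obtain ⟨l, hl⟩ := hv
  have hcomm (z : G) : Commute (v⁻¹ * u) z :=
    (Subgroup.mem_center_iff.1 (mul_mem (inv_mem hvc) huc) z).symm
  have hws : w = v⁻¹ * u * s := by rw [mul_assoc, ← h, inv_mul_cancel_left]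
  have hpart : (v⁻¹ * u) ^ p ^ (k + l) = 1 := by
    have hvu : Commute v⁻¹ u := Subgroup.mem_center_iff.1 huc v⁻¹
    rw [hvu.mul_pow, inv_pow, pow_add, pow_mul u, ← hk, pow_orderOf_eq_one, one_pow, mul_comm,
      pow_mul, ← hl, pow_orderOf_eq_one, one_pow, inv_one, one_mul]
  have hregular : (v⁻¹ * u) ^ (orderOf w * orderOf s) = 1 := by
    have h1 : w ^ (orderOf w * orderOf s) = 1 := by rw [pow_mul, pow_orderOf_eq_one, one_pow]
    have h2 : s ^ (orderOf w * orderOf s) = 1 := by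
      rw [mul_comm, pow_mul, pow_orderOf_eq_one, one_pow]
    have h3 := (hcomm s).mul_pow (orderOf w * orderOf s)
    rwa [← hws, h1, h2, mul_one, eq_comm] at h3
  have hcop : Nat.Coprime (p ^ (k + l)) (orderOf w * orderOf s) :=
    Nat.Coprime.pow_left _ ((hp.coprime_iff_not_dvd.2 hw).mul_right (hp.coprime_iff_not_dvd.2 hs))
  have hone : orderOf (v⁻¹ * u) = 1 := Nat.eq_one_of_dvd_coprimes hcop
    (orderOf_dvd_of_pow_eq_one hpart) (orderOf_dvd_of_pow_eq_one hregular)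
  exact inv_mul_eq_one.1 (orderOf_eq_one_iff.1 hone)

/-- Left translation by a central element preserves centralizers. -/
theorem centralizer_central_mul {G : Type} [Group G] {z : G} (hz : z ∈ Subgroup.center G)
    (x : G) : Subgroup.centralizer {z * x} = Subgroup.centralizer {x} := by
  ext a
  have ha := Subgroup.mem_center_iff.1 hz a
  rw [Subgroup.mem_centralizer_singleton_iff, Subgroup.mem_centralizer_singleton_iff,
    ← mul_assoc, ha, mul_assoc, mul_assoc, mul_right_inj]

/-- Let `P` be a central `p`-subgroup of `G` and `K` a conjugacy class with defect group `P`.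
If `x = u·s ∈ K` with `u` the `p`-part of `x` and `s` its `p'`-part, then `u ∈ P`, every element
of `K` has `p`-part `u`, and `u⁻¹K` is a `p`-regular conjugacy class with defect group `P`. -/
theorem stmt7 (G : Type) [Group G] [Fintype G] (p : ℕ) [Fact p.Prime]
    (P : Subgroup G) (hP : IsPGroup p P) (hcentral : P ≤ Subgroup.center G)
    (K : ConjClasses G) (hK : IsClassDefectGroup p P K)
    (x : G) (hx : x ∈ K.carrier) (u s : G) (hus : x = u * s) (hcomm : u * s = s * u)
    (hu : ∃ k : ℕ, orderOf u = p ^ k) (hs : ¬ p ∣ orderOf s) :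
    u ∈ P ∧
    (∀ y ∈ K.carrier, ∀ v w : G, y = v * w → v * w = w * v →
      (∃ k : ℕ, orderOf v = p ^ k) → ¬ p ∣ orderOf w → v = u) ∧
    ∃ K' : ConjClasses G, K'.carrier = (fun y => u⁻¹ * y) '' K.carrier ∧
      (∀ y ∈ K'.carrier, ¬ p ∣ orderOf y) ∧ IsClassDefectGroup p P K' := by
  have huP : u ∈ P := hK.mem_of_commute hcentral hx
    (by rw [hus]; exact (Commute.refl u).mul_right hcomm) hu
  have huc := hcentral huP
  have hconj (g z : G) : g * (u * z) * g⁻¹ = u * (g * z * g⁻¹) := by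
    rw [← mul_assoc g u, Subgroup.mem_center_iff.1 huc g]
    group
  have hmem (y : G) : y ∈ K.carrier ↔ ∃ g, g * x * g⁻¹ = y := by
    rw [ConjClasses.mem_carrier_iff_mk_eq] at hx
    rw [ConjClasses.mem_carrier_iff_mk_eq, ← isConj_iff, ← hx, eq_comm,
      ConjClasses.mk_eq_mk_iff_isConj]
  have hcarrier : (ConjClasses.mk s).carrier = (fun y => u⁻¹ * y) '' K.carrier := by
    ext z
    rw [ConjClasses.mem_carrier_iff_mk_eq, eq_comm, ConjClasses.mk_eq_mk_iff_isConj, isConj_iff]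
    constructor
    · rintro ⟨g, rfl⟩
      exact ⟨g * x * g⁻¹, (hmem _).2 ⟨g, rfl⟩, by simp only [hus, hconj, inv_mul_cancel_left]⟩
    · rintro ⟨y, hy, rfl⟩
      obtain ⟨g, rfl⟩ := (hmem y).1 hy
      exact ⟨g, by simp only [hus, hconj, inv_mul_cancel_left]⟩
  have horder (g : G) : orderOf (g * s * g⁻¹) = orderOf s :=
    (MulAut.conj g).orderOf_eq s
  refine ⟨huP, ?_, ConjClasses.mk s, hcarrier, ?_, ?_⟩
  · intro y hy v w hvw hvwc hv hw
    have hvP : v ∈ P := hK.mem_of_commute hcentral hy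
      (by rw [hvw]; exact (Commute.refl v).mul_right hvwc) hv
    obtain ⟨g, hg⟩ := (hmem y).1 hy
    refine eq_of_central_mul_eq_mul (s := g * s * g⁻¹) huc (hcentral hvP) hu hv ?_ hw ?_
    · rwa [horder]
    · rw [← hvw, ← hg, hus, hconj]
  · intro y hy
    rw [ConjClasses.mem_carrier_iff_mk_eq, eq_comm, ConjClasses.mk_eq_mk_iff_isConj,
      isConj_iff] at hy
    obtain ⟨g, rfl⟩ := hy
    rwa [horder]
  · obtain ⟨y, hy, hS⟩ := hK
    refine ⟨u⁻¹ * y, hcarrier ▸ ⟨y, hy, rfl⟩, ?_⟩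
    rwa [centralizer_central_mul (inv_mem huc)]
end

section
/- Let P be a central p-subgroup of the finite group G, let ν : FG → F[G/P] be the F-algebra homomorphism induced by the canonical projection G → G/P, and let K be a conjugacy class of G having P as a defect group. Then ν(K^+) lies in the F-span of the class sums of those conjugacy classes of G/P that have trivial defect group (defect zero). -/
set_option synthInstance.maxHeartbeats 1000000
set_option maxHeartbeats 1000000

open scoped Classical

/-- The elements `q` of a central subgroup `P` for which `x * q` is conjugate to `x`. -/
def conjTranslates {G : Type} [Group G] (P : Subgroup G) (hP : P ≤ Subgroup.center G) (x : G) :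
    Subgroup G where
  carrier := {q | q ∈ P ∧ IsConj x (x * q)}
  one_mem' := ⟨P.one_mem, by simpa using IsConj.refl x⟩
  mul_mem' := by
    rintro a b ⟨ha, ha'⟩ ⟨hb, hb'⟩
    refine ⟨P.mul_mem ha hb, ha'.trans ?_⟩
    obtain ⟨c, hc⟩ := isConj_iff.1 hb'
    have hac := Subgroup.mem_center_iff.1 (hP ha)
    refine isConj_iff.2 ⟨c, ?_⟩
    calc c * (x * a) * c⁻¹ = c * x * (a * c⁻¹) := by group
      _ = c * x * c⁻¹ * a := by rw [← hac]; group
      _ = x * (a * b) := by rw [hc, mul_assoc, hac]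
  inv_mem' := by
    rintro a ⟨ha, ha'⟩
    refine ⟨P.inv_mem ha, ?_⟩
    obtain ⟨c, hc⟩ := isConj_iff.1 ha'
    have hac := Subgroup.mem_center_iff.1 (hP (P.inv_mem ha))
    refine isConj_iff.2 ⟨c⁻¹, ?_⟩
    have hx : x = c⁻¹ * (x * a) * c := by rw [← hc]; group
    calc c⁻¹ * x * c⁻¹⁻¹ = c⁻¹ * (x * a * a⁻¹) * c := by group
      _ = c⁻¹ * (x * a) * (a⁻¹ * c) := by group
      _ = c⁻¹ * (x * a) * c * a⁻¹ := by rw [← hac]; group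
      _ = x * a⁻¹ := by rw [← hx]

theorem mem_conjTranslates {G : Type} [Group G] {P : Subgroup G} {hP : P ≤ Subgroup.center G}
    {x q : G} : q ∈ conjTranslates P hP x ↔ q ∈ P ∧ IsConj x (x * q) :=
  Iff.rfl

theorem classSum_coeff (F : Type) [Field F] {G : Type} [Group G] [Fintype G]
    (K : ConjClasses G) (z : G) : (classSum F K).coeff z = if z ∈ K.carrier then 1 else 0 := by
  rw [classSum, MonoidAlgebra.coeff_sum, Finset.sum_apply', Finset.sum_eq_single z]
  · split_ifs <;> simp
  · intro y _ hy
    split_ifs <;> simp [hy]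
  · simp

/-- The fibre of `K → G ⧸ P` over a conjugate of the image of `x ∈ K` has as many elements as
`conjTranslates P hP x`. -/
theorem card_fibre_eq {G : Type} [Group G] [Fintype G] (P : Subgroup G) [P.Normal]
    (hP : P ≤ Subgroup.center G) (x g : G) :
    (Finset.univ.filter fun y : G => IsConj x y ∧
      (y : G ⧸ P) = ((g * x * g⁻¹ : G) : G ⧸ P)).card = Nat.card (conjTranslates P hP x) := by
  rw [Nat.card_eq_fintype_card, Fintype.card_subtype]
  symm
  refine Finset.card_bij (fun q _ => g * (x * q) * g⁻¹) ?_ ?_ ?_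
  · intro q hq
    simp only [Finset.mem_filter, Finset.mem_univ, true_and] at hq ⊢
    obtain ⟨hqP, hq⟩ := mem_conjTranslates.1 hq
    refine ⟨hq.trans (isConj_iff.2 ⟨g, rfl⟩), ?_⟩
    simp [(QuotientGroup.eq_one_iff q).2 hqP]
  · intro a _ b _ h
    simpa using h
  · intro y hy
    simp only [Finset.mem_filter, Finset.mem_univ, true_and] at hy ⊢
    refine ⟨x⁻¹ * (g⁻¹ * y * g), mem_conjTranslates.2 ⟨?_, ?_⟩, by group⟩
    · rw [← QuotientGroup.eq_one_iff]
      calc ((x⁻¹ * (g⁻¹ * y * g) : G) : G ⧸ P)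
          = (x : G ⧸ P)⁻¹ * ((g : G ⧸ P)⁻¹ * (y : G ⧸ P) * g) := rfl
        _ = (x : G ⧸ P)⁻¹ * ((g : G ⧸ P)⁻¹ * ((g * x * g⁻¹ : G) : G ⧸ P) * g) := by rw [hy.2]
        _ = (x : G ⧸ P)⁻¹ * ((g : G ⧸ P)⁻¹ * ((g : G ⧸ P) * x * (g : G ⧸ P)⁻¹) * g) := rfl
        _ = 1 := by group
    · refine hy.1.trans (isConj_iff.2 ⟨g⁻¹, by group⟩)

/-- If `P` is a Sylow subgroup of the centralizer of `x` and no nontrivial translate of `x` by `P`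
is conjugate to `x`, then the centralizer of the image of `x` in `G ⧸ P` is a `p'`-group. -/
theorem sylow_centralizer_mk_eq_bot {G : Type} [Group G] [Fintype G] (p : ℕ) [Fact p.Prime]
    (P : Subgroup G) [P.Normal] (hP : IsPGroup p P) (hcentral : P ≤ Subgroup.center G)
    (x : G) (S : Sylow p ↥(Subgroup.centralizer {x}))
    (hS : P = Subgroup.map (Subgroup.centralizer {x}).subtype S.toSubgroup)
    (hH : conjTranslates P hcentral x = ⊥)
    (T : Sylow p ↥(Subgroup.centralizer {(x : G ⧸ P)})) : T.toSubgroup = ⊥ := by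
  rw [eq_bot_iff]
  rintro ⟨t, ht⟩ htT
  obtain ⟨u, rfl⟩ := QuotientGroup.mk_surjective t
  rw [Subgroup.mem_bot, Subtype.ext_iff]
  change (u : G ⧸ P) = 1
  rw [QuotientGroup.eq_one_iff]
  have hux : u ∈ Subgroup.centralizer {x} := by
    rw [Subgroup.mem_centralizer_singleton_iff] at ht ⊢
    have hq : x⁻¹ * (u * x * u⁻¹) ∈ P := by
      rw [← QuotientGroup.eq_one_iff]
      calc ((x⁻¹ * (u * x * u⁻¹) : G) : G ⧸ P)
          = (x : G ⧸ P)⁻¹ * ((u : G ⧸ P) * x * (u : G ⧸ P)⁻¹) := rfl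
        _ = 1 := by rw [ht]; group
    have : x⁻¹ * (u * x * u⁻¹) ∈ conjTranslates P hcentral x :=
      mem_conjTranslates.2 ⟨hq, isConj_iff.2 ⟨u, by group⟩⟩
    rw [hH, Subgroup.mem_bot, inv_mul_eq_one] at this
    nth_rw 2 [this]; group
  obtain ⟨k, hk⟩ := T.isPGroup' ⟨_, htT⟩
  have hk' : u ^ p ^ k ∈ P := by
    rw [← QuotientGroup.eq_one_iff]
    simpa [Subtype.ext_iff] using hk
  obtain ⟨l, hl⟩ := hP ⟨_, hk'⟩
  have hl' : u ^ p ^ (k + l) = 1 := by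
    rw [pow_add, pow_mul]
    simpa [Subtype.ext_iff] using hl
  have hz : IsPGroup p (Subgroup.zpowers (⟨u, hux⟩ : ↥(Subgroup.centralizer {x}))) := by
    rw [isPGroup_iff_pow_pow_eq_one]
    rintro ⟨_, m, rfl⟩
    refine ⟨k + l, ?_⟩
    rw [Subtype.ext_iff, Subtype.ext_iff]
    change (u ^ m) ^ p ^ (k + l) = 1
    rw [← zpow_natCast, zpow_comm, zpow_natCast, hl', one_zpow]
  have hSn : S.toSubgroup.Normal := by
    refine ⟨fun s hs c => ?_⟩
    have hsP : (s : G) ∈ P := hS ▸ ⟨s, hs, rfl⟩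
    have hc : c * s * c⁻¹ = s := by
      rw [Subtype.ext_iff]
      change (c : G) * s * (c : G)⁻¹ = s
      rw [Subgroup.mem_center_iff.1 (hcentral hsP), mul_inv_cancel_right]
    rwa [hc]
  have := S.is_maximal' (IsPGroup.to_sup_of_normal_left S.isPGroup' hz) le_sup_left
  rw [hS]
  refine ⟨⟨u, hux⟩, ?_, rfl⟩
  change _ ∈ S.toSubgroup
  rw [← this]
  exact (le_sup_right : _ ≤ S.toSubgroup ⊔ _) (Subgroup.mem_zpowers _)

/-- The image of a class sum in `F[G/P]` is a multiple of the class sum of the image class. -/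
theorem mapDomainAlgHom_classSum (F : Type) [Field F] {G : Type} [Group G] [Fintype G]
    (P : Subgroup G) [P.Normal] (hP : P ≤ Subgroup.center G) (x : G) :
    MonoidAlgebra.mapDomainAlgHom F F (QuotientGroup.mk' P) (classSum F (ConjClasses.mk x)) =
      (Nat.card (conjTranslates P hP x) : F) • classSum F (ConjClasses.mk (x : G ⧸ P)) := by
  ext z
  have hz : (MonoidAlgebra.mapDomainAlgHom F F (QuotientGroup.mk' P)
      (classSum F (ConjClasses.mk x))).coeff z =
      ((Finset.univ.filter fun y : G => IsConj x y ∧ (y : G ⧸ P) = z).card : F) := by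
    rw [classSum, map_sum, MonoidAlgebra.coeff_sum, Finset.sum_apply', Finset.card_filter,
      Nat.cast_sum]
    refine Finset.sum_congr rfl fun y _ => ?_
    have hmem : y ∈ (ConjClasses.mk x).carrier ↔ IsConj x y := by
      rw [ConjClasses.mem_carrier_iff_mk_eq, ConjClasses.mk_eq_mk_iff_isConj, isConj_comm]
    by_cases hy : IsConj x y
    · rw [if_pos (hmem.2 hy)]
      simp only [hy, true_and]
      simp [Finsupp.single_apply]
    · rw [if_neg (mt hmem.1 hy), if_neg fun h => hy h.1]
      simp
  rw [hz, MonoidAlgebra.coeff_smul, Finsupp.smul_apply, classSum_coeff]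
  split_ifs with h
  · rw [ConjClasses.mem_carrier_iff_mk_eq, ConjClasses.mk_eq_mk_iff_isConj] at h
    obtain ⟨c, rfl⟩ := isConj_iff.1 h.symm
    obtain ⟨g, rfl⟩ := QuotientGroup.mk_surjective c
    rw [smul_eq_mul, mul_one, ← card_fibre_eq P hP x g]
    rfl
  · rw [smul_zero, Finset.filter_eq_empty_iff.2, Finset.card_empty, Nat.cast_zero]
    rintro y - ⟨hy, rfl⟩
    refine h ?_
    rw [ConjClasses.mem_carrier_iff_mk_eq, ConjClasses.mk_eq_mk_iff_isConj]
    exact ((QuotientGroup.mk' P).map_isConj hy).symm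

/-- If `P` is a central `p`-subgroup of `G`, `ν : FG → F[G/P]` the canonical epimorphism and `K`
a conjugacy class of `G` with defect group `P`, then `ν(K⁺)` lies in the span of the class sums
of the defect-zero conjugacy classes of `G/P`. -/
theorem stmt9 (F : Type) [Field F] [IsAlgClosed F] (G : Type) [Group G] [Fintype G]
    (p : ℕ) [Fact p.Prime] [CharP F p]
    (P : Subgroup G) [P.Normal] (hP : IsPGroup p P) (hcentral : P ≤ Subgroup.center G)
    (K : ConjClasses G) (hK : IsClassDefectGroup p P K) :
    MonoidAlgebra.mapDomainAlgHom F F (QuotientGroup.mk' P) (classSum F K) ∈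
      Submodule.span F {a : MonoidAlgebra F (G ⧸ P) |
        ∃ L : ConjClasses (G ⧸ P), IsClassDefectGroup p (⊥ : Subgroup (G ⧸ P)) L ∧
          a = classSum F L} := by
  obtain ⟨x, hx, S, hS⟩ := hK
  obtain rfl : ConjClasses.mk x = K := ConjClasses.mem_carrier_iff_mk_eq.1 hx
  rw [mapDomainAlgHom_classSum F P hcentral x]
  by_cases hH : conjTranslates P hcentral x = ⊥
  · refine Submodule.smul_mem _ _ (Submodule.subset_span ⟨_, ⟨_, ConjClasses.mem_carrier_mk,
      default, ?_⟩, rfl⟩)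
    rw [sylow_centralizer_mk_eq_bot p P hP hcentral x S hS hH, Subgroup.map_bot]
  · have hHp : IsPGroup p (conjTranslates P hcentral x) := hP.to_le fun _ hq => hq.1
    have : Nontrivial (conjTranslates P hcentral x) :=
      (Subgroup.nontrivial_iff_ne_bot _).2 hH
    obtain ⟨n, hn, hcard⟩ := hHp.nontrivial_iff_card.1 this
    rw [hcard, Nat.cast_pow, CharP.cast_eq_zero, zero_pow hn.ne', zero_smul]
    exact Submodule.zero_mem _
end

section
/- Let K be a conjugacy class of the finite group G of defect zero, i.e. p does not divide |C_G(x)| for x ∈ K. Then the class sum K^+ annihilates the Jacobson radical of FG: K^+ · J(FG) = 0. -/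
set_option synthInstance.maxHeartbeats 1000000
set_option maxHeartbeats 1000000

open scoped Classical

/-- Elements of the Jacobson radical of an Artinian ring are nilpotent. -/
theorem isNilpotent_of_mem_jacobson_bot {R : Type*} [Ring R] [IsArtinianRing R] {b : R}
    (hb : b ∈ Ideal.jacobson (⊥ : Ideal R)) : IsNilpotent b := by
  obtain ⟨n, hn⟩ := IsArtinianRing.isNilpotent_jacobson_bot (R := R)
  refine ⟨n, ?_⟩
  have h := Ideal.pow_mem_pow hb n
  rwa [hn] at h

/-- The number of elements conjugating `z` to a given conjugate is the order of the centralizer. -/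
theorem card_filter_inv_mul_mul_eq {G : Type*} [Group G] [Fintype G] (z g₀ : G) :
    (Finset.univ.filter fun g : G ↦ g⁻¹ * z * g = g₀⁻¹ * z * g₀).card =
      Nat.card (Subgroup.centralizer {z}) := by
  rw [Nat.card_eq_fintype_card, ← Finset.card_univ]
  symm
  refine Finset.card_bij (fun c _ ↦ (c : G) * g₀) ?_ ?_ ?_
  · rintro ⟨c, hc⟩ -
    have hc : z * c = c * z := Subgroup.mem_centralizer_singleton_iff.mp hc |>.symm
    simp only [Finset.mem_filter, Finset.mem_univ, true_and, mul_inv_rev]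
    calc g₀⁻¹ * c⁻¹ * z * (c * g₀) = g₀⁻¹ * c⁻¹ * (z * c) * g₀ := by group
      _ = g₀⁻¹ * z * g₀ := by rw [hc]; group
  · intro c _ d _ h
    exact Subtype.ext (mul_right_cancel h)
  · intro g hg
    simp only [Finset.mem_filter, Finset.mem_univ, true_and] at hg
    refine ⟨⟨g * g₀⁻¹, Subgroup.mem_centralizer_singleton_iff.mpr ?_⟩, Finset.mem_univ _, by simp⟩
    calc g * g₀⁻¹ * z = g * (g₀⁻¹ * z * g₀) * g₀⁻¹ := by group
      _ = z * (g * g₀⁻¹) := by rw [← hg]; group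

/-- The trace of `v ↦ z * v * b` on the group algebra. -/
theorem trace_mulLeft_comp_mulRight (F : Type*) [Field F] {G : Type*} [Group G] [Fintype G]
    (z : G) (b : MonoidAlgebra F G) :
    LinearMap.trace F (MonoidAlgebra F G)
      (LinearMap.mulLeft F (MonoidAlgebra.single z 1) * LinearMap.mulRight F b) =
      ∑ g : G, b.coeff (g⁻¹ * z * g)⁻¹ := by
  rw [LinearMap.trace_eq_matrix_trace F (MonoidAlgebra.basis G F), Matrix.trace]
  refine Finset.sum_congr rfl fun g _ ↦ ?_
  simp [LinearMap.toMatrix_apply, MonoidAlgebra.basis, mul_assoc]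

/-- Averaging a function of the conjugates of `z` over the group. -/
theorem sum_conj_eq_card_centralizer_mul {F : Type*} [Semiring F] {G : Type*} [Group G]
    [Fintype G] (K : ConjClasses G) {z : G} (hz : z ∈ K.carrier) (f : G → F) :
    ∑ g : G, f (g⁻¹ * z * g) =
      Nat.card (Subgroup.centralizer {z}) * ∑ x ∈ Finset.univ.filter (· ∈ K.carrier), f x := by
  have hK : K = ConjClasses.mk z := (ConjClasses.mem_carrier_iff_mk_eq.mp hz).symm
  have hmem (x : G) : x ∈ K.carrier ↔ ∃ g : G, g⁻¹ * z * g = x := by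
    rw [ConjClasses.mem_carrier_iff_mk_eq, hK, ConjClasses.mk_eq_mk_iff_isConj, isConj_comm,
      isConj_iff]
    exact ⟨fun ⟨c, hc⟩ ↦ ⟨c⁻¹, by simpa using hc⟩, fun ⟨c, hc⟩ ↦ ⟨c⁻¹, by simpa using hc⟩⟩
  rw [← Finset.sum_fiberwise_of_maps_to (s := Finset.univ)
    (t := Finset.univ.filter (· ∈ K.carrier)) (g := fun g : G ↦ g⁻¹ * z * g)
    (by intro g _; simp [hmem]), Finset.mul_sum]
  refine Finset.sum_congr rfl fun x hx ↦ ?_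
  obtain ⟨g₀, rfl⟩ := (hmem x).mp (Finset.mem_filter.mp hx).2
  rw [Finset.sum_congr rfl (g := fun _ ↦ f (g₀⁻¹ * z * g₀))
    (fun g hg ↦ by rw [(Finset.mem_filter.mp hg).2]), Finset.sum_const,
    card_filter_inv_mul_mul_eq, nsmul_eq_mul]

/-- If `K` is a conjugacy class of defect zero, i.e. `p ∤ |C_G(x)|` for `x ∈ K`, then the class
sum `K⁺` annihilates the Jacobson radical of `FG`: `K⁺ · J(FG) = 0`. -/
theorem stmt10 (F : Type) [Field F] [IsAlgClosed F] (G : Type) [Group G] [Fintype G]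
    (p : ℕ) [Fact p.Prime] [CharP F p]
    (K : ConjClasses G)
    (hK : ∀ x ∈ K.carrier, ¬ p ∣ Nat.card ↥(Subgroup.centralizer {x})) :
    ∀ a ∈ Ideal.jacobson (⊥ : Ideal (MonoidAlgebra F G)), classSum F K * a = 0 := by
  intro a ha
  obtain ⟨z, rfl⟩ := ConjClasses.exists_rep K
  set K := ConjClasses.mk z
  have hz : z ∈ K.carrier := ConjClasses.mem_carrier_mk
  have hcard : (Nat.card (Subgroup.centralizer {z}) : F) ≠ 0 := by
    rw [Ne, CharP.cast_eq_zero_iff F p]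
    exact hK z hz
  have : IsArtinianRing (MonoidAlgebra F G) := IsArtinianRing.of_finite F _
  ext g
  have hb : a * MonoidAlgebra.single g⁻¹ 1 ∈ Ideal.jacobson (⊥ : Ideal (MonoidAlgebra F G)) :=
    Ideal.mul_mem_right _ _ ha
  have hnil : IsNilpotent (LinearMap.mulLeft F (MonoidAlgebra.single z (1 : F)) *
      LinearMap.mulRight F (a * MonoidAlgebra.single g⁻¹ 1)) := by
    refine (LinearMap.commute_mulLeft_right (R := F) _ _).isNilpotent_mul_left ?_
    exact (LinearMap.isNilpotent_mulRight_iff F _).mpr (isNilpotent_of_mem_jacobson_bot hb)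
  have htr := (LinearMap.isNilpotent_trace_of_isNilpotent hnil).eq_zero
  rw [trace_mulLeft_comp_mulRight,
    sum_conj_eq_card_centralizer_mul K hz
      fun x ↦ (a * MonoidAlgebra.single g⁻¹ (1 : F)).coeff x⁻¹] at htr
  have hsum := (mul_eq_zero.mp htr).resolve_left hcard
  rw [classSum, ← Finset.sum_filter, Finset.sum_mul]
  simpa using hsum
end

section
/- Let F be a field of characteristic p > 0 and let P be a finite abelian p-group of order p^{im+j} with 0 ≤ j < m, whose exponent divides p^m. Then J(FP)^{i(p^m−1) + p^j} = 0; that is, the Loewy length of FP is at most i(p^m−1) + p^j. -/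
set_option synthInstance.maxHeartbeats 1000000
set_option maxHeartbeats 1000000

section NumberInequality

lemma pow_sub_one_add_pow_sub_one_le {p : ℕ} (hp : 0 < p) (a b : ℕ) :
    (p ^ a - 1) + (p ^ b - 1) ≤ p ^ (a + b) - 1 := by
  obtain ⟨A, hA⟩ := Nat.exists_eq_add_of_le' (Nat.pow_pos (n := a) hp)
  obtain ⟨B, hB⟩ := Nat.exists_eq_add_of_le' (Nat.pow_pos (n := b) hp)
  rw [pow_add, hA, hB]
  have : (A + 1) * (B + 1) = A * B + A + B + 1 := by ring
  simp only [Nat.add_sub_cancel, this]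
  linarith [Nat.zero_le (A * B)]

lemma pow_sub_one_add_pow_sub_one_le_of_add_eq {p : ℕ} (hp : 0 < p) {a b c m : ℕ}
    (ha : a ≤ m) (hb : b ≤ m) (h : a + b = m + c) :
    (p ^ a - 1) + (p ^ b - 1) ≤ (p ^ m - 1) + (p ^ c - 1) := by
  obtain ⟨d, rfl⟩ := Nat.exists_eq_add_of_le ha
  obtain rfl : b = c + d := by omega
  have hca : p ^ c ≤ p ^ a := Nat.pow_le_pow_right hp (by omega)
  have hpos : ∀ n, 1 ≤ p ^ n := fun n => Nat.pow_pos hp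
  have key : p ^ a + p ^ (c + d) ≤ p ^ (a + d) + p ^ c := by
    rw [pow_add, pow_add]
    have hd := hpos d
    obtain ⟨D, hD⟩ := Nat.exists_eq_add_of_le' hd
    obtain ⟨A, hA⟩ := Nat.exists_eq_add_of_le hca
    rw [hD, hA]
    nlinarith [Nat.zero_le (A * D)]
  have h1 := hpos a
  have h2 := hpos (c + d)
  have h3 := hpos (a + d)
  have h4 := hpos c
  omega

lemma sum_pow_sub_one_le {ι : Type*} {p m : ℕ} (hp : 0 < p) (hm : 0 < m) (s : Finset ι)
    (a : ι → ℕ) (ha : ∀ k ∈ s, a k ≤ m) :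
    ∑ k ∈ s, (p ^ a k - 1) ≤
      (∑ k ∈ s, a k) / m * (p ^ m - 1) + (p ^ ((∑ k ∈ s, a k) % m) - 1) := by
  classical
  induction s using Finset.induction_on with
  | empty => simp
  | insert k s hk ih =>
    rw [Finset.sum_insert hk, Finset.sum_insert hk]
    have ih := ih fun l hl => ha l (Finset.mem_insert_of_mem hl)
    have hak := ha k (Finset.mem_insert_self k s)
    set S := ∑ k ∈ s, a k
    have hlt := Nat.mod_lt S hm
    have hS := Nat.div_add_mod S m
    generalize S / m = q at *
    generalize S % m = r at *
    rw [← hS]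
    by_cases h : a k + r < m
    · rw [show a k + (m * q + r) = (a k + r) + m * q by ring, Nat.add_mul_div_left _ _ hm,
        Nat.add_mul_mod_self_left, Nat.div_eq_of_lt h, Nat.mod_eq_of_lt h, zero_add]
      have := pow_sub_one_add_pow_sub_one_le hp (a k) r
      omega
    · obtain ⟨c, hc⟩ := Nat.exists_eq_add_of_le (not_lt.mp h)
      have hcm : c < m := by omega
      rw [show a k + (m * q + r) = c + m * (q + 1) by rw [mul_add]; omega,
        Nat.add_mul_div_left _ _ hm, Nat.add_mul_mod_self_left, Nat.div_eq_of_lt hcm,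
        Nat.mod_eq_of_lt hcm, zero_add, add_mul, one_mul]
      have := pow_sub_one_add_pow_sub_one_le_of_add_eq hp hak hlt.le hc
      omega

end NumberInequality

lemma Ideal.sup_pow_add_add_one_eq_bot {A : Type*} [CommRing A] {I J : Ideal A} {n m : ℕ}
    (hI : I ^ (n + 1) = ⊥) (hJ : J ^ (m + 1) = ⊥) : (I ⊔ J) ^ (n + m + 1) = ⊥ := by
  rw [← Ideal.zero_eq_bot] at *
  rw [← Ideal.add_eq_sup, add_pow]
  refine Finset.sum_eq_zero fun k _ => ?_
  by_cases h : n + 1 ≤ k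
  · rw [pow_eq_zero_of_le h hI, zero_mul, zero_mul]
  · rw [pow_eq_zero_of_le (show m + 1 ≤ n + m + 1 - k by omega) hJ, mul_zero, zero_mul]

lemma Ideal.finset_sup_span_singleton_pow_eq_bot {A ι : Type*} [CommRing A] (s : Finset ι)
    (y : ι → A) (d : ι → ℕ) (h : ∀ k ∈ s, y k ^ (d k + 1) = 0) :
    (s.sup fun k => Ideal.span {y k}) ^ (∑ k ∈ s, d k + 1) = ⊥ := by
  classical
  induction s using Finset.induction_on with
  | empty => simp
  | insert k s hk ih =>
    rw [Finset.sum_insert hk, Finset.sup_insert]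
    refine Ideal.sup_pow_add_add_one_eq_bot ?_ (ih fun l hl => h l (Finset.mem_insert_of_mem hl))
    rw [Ideal.span_singleton_pow, h k (Finset.mem_insert_self k s), Ideal.span_singleton_eq_bot]

/-- The Jacobson radical of a commutative group algebra lies in every ideal containing `x - 1`
for all `x` in a generating set. -/
lemma MonoidAlgebra.jacobson_bot_le_of_closure_eq_top {F P : Type*} [Field F] [CommGroup P]
    {I : Ideal (MonoidAlgebra F P)} {s : Set P} (hs : Subgroup.closure s = ⊤)
    (hI : ∀ x ∈ s, MonoidAlgebra.of F P x - 1 ∈ I) :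
    Ideal.jacobson (⊥ : Ideal (MonoidAlgebra F P)) ≤ I := by
  let ε : MonoidAlgebra F P →ₐ[F] F := MonoidAlgebra.lift F F P 1
  have hε : Function.Surjective ε := fun a => ⟨algebraMap F _ a, ε.commutes a⟩
  have hmax : (RingHom.ker ε).IsMaximal := RingHom.ker_isMaximal_of_surjective ε hε
  have hone : (Ideal.Quotient.mk I).toMonoidHom.comp (MonoidAlgebra.of F P) = 1 := by
    rw [← MonoidHom.ker_eq_top_iff, eq_top_iff, ← hs, Subgroup.closure_le]
    intro x hx
    rw [SetLike.mem_coe, MonoidHom.mem_ker]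
    have h : Ideal.Quotient.mk I (MonoidAlgebra.of F P x) = Ideal.Quotient.mk I 1 :=
      (Ideal.Quotient.mk_eq_mk_iff_sub_mem _ _).mpr (hI x hx)
    exact h.trans (map_one (Ideal.Quotient.mk I))
  have hmk : Ideal.Quotient.mkₐ F I = (Algebra.ofId F _).comp ε := by
    ext g
    have := DFunLike.congr_fun hone g
    simpa [ε] using this
  refine le_trans (sInf_le ⟨bot_le, hmax⟩) fun x hx => ?_
  have := DFunLike.congr_fun hmk x
  rw [RingHom.mem_ker] at hx
  rw [AlgHom.comp_apply, hx, map_zero] at this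
  exact Ideal.Quotient.eq_zero_iff_mem.mp this

/-- A finite commutative group has independent generators: the product of their orders is
the order of the group. -/
lemma CommGroup.exists_generators_prod_orderOf (P : Type*) [CommGroup P] [Finite P] :
    ∃ (ι : Type) (_ : Fintype ι) (x : ι → P),
      Subgroup.closure (Set.range x) = ⊤ ∧ ∏ k, orderOf (x k) = Nat.card P := by
  classical
  obtain ⟨ι, _, n, hn, ⟨e⟩⟩ := CommGroup.equiv_prod_multiplicative_zmod_of_finite P
  refine ⟨ι, inferInstance,
    fun k => e.symm (Pi.mulSingle k (Multiplicative.ofAdd (1 : ZMod (n k)))), ?_, ?_⟩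
  · rw [eq_top_iff]
    intro g _
    rw [← e.symm_apply_apply g, ← Finset.univ_prod_mulSingle (e g), map_prod]
    refine Subgroup.prod_mem _ fun k _ => ?_
    obtain ⟨z, hz⟩ := ZMod.intCast_surjective (Multiplicative.toAdd (e g k))
    have hz' : e g k = Multiplicative.ofAdd (1 : ZMod (n k)) ^ z := by
      rw [← ofAdd_zsmul, zsmul_one, hz, ofAdd_toAdd]
    rw [hz', Pi.mulSingle_zpow, map_zpow]
    exact Subgroup.zpow_mem _ (Subgroup.subset_closure (Set.mem_range_self k)) z
  · rw [Nat.card_congr e.toEquiv, Nat.card_pi]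
    refine Finset.prod_congr rfl fun k _ => ?_
    rw [MulEquiv.orderOf_eq, orderOf_piMulSingle, orderOf_ofAdd_eq_addOrderOf,
      ZMod.addOrderOf_one]
    exact (Nat.card_zmod (n k)).symm

/-- If `P` is a finite abelian `p`-group of order `p^(i·m+j)` with `0 ≤ j < m` whose exponent
divides `p^m`, and `F` is a field of characteristic `p`, then `J(FP)^(i(p^m-1)+p^j) = 0`. -/
theorem stmt12 (F : Type) [Field F] (p : ℕ) [Fact p.Prime] [CharP F p]
    (P : Type) [CommGroup P] [Fintype P] (i m j : ℕ) (hj : j < m)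
    (hcard : Fintype.card P = p ^ (i * m + j)) (hexp : ∀ x : P, x ^ (p ^ m) = 1) :
    (Ideal.jacobson (⊥ : Ideal (MonoidAlgebra F P))) ^ (i * (p ^ m - 1) + p ^ j) = ⊥ := by
  have hp : p.Prime := Fact.out
  obtain ⟨ι, _, x, hx, hprod⟩ := CommGroup.exists_generators_prod_orderOf P
  choose a ham ha using fun k => (Nat.dvd_prime_pow hp).mp (orderOf_dvd_of_pow_eq_one (hexp (x k)))
  have hsum : ∑ k, a k = i * m + j := by
    refine Nat.pow_right_injective hp.two_le ?_
    simp only [← Finset.prod_pow_eq_pow_sum, ← ha, hprod, Nat.card_eq_fintype_card, hcard]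
  have hle := sum_pow_sub_one_le hp.pos (by omega : 0 < m) Finset.univ a fun k _ => ham k
  have hm : 0 < m := by omega
  rw [hsum, add_comm (i * m), Nat.add_mul_div_right _ _ hm, Nat.add_mul_mod_self_right,
    Nat.div_eq_of_lt hj, Nat.mod_eq_of_lt hj, zero_add] at hle
  have hpos : 0 < p ^ j := Nat.pow_pos hp.pos
  have hchar : CharP (MonoidAlgebra F P) p :=
    charP_of_injective_algebraMap (algebraMap F (MonoidAlgebra F P)).injective p
  have hnil : ∀ k, (MonoidAlgebra.of F P (x k) - 1) ^ (p ^ a k - 1 + 1) = 0 := fun k => by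
    rw [Nat.sub_add_cancel (Nat.pow_pos hp.pos), sub_pow_char_pow, one_pow, ← map_pow, ← ha,
      pow_orderOf_eq_one, map_one, sub_self]
  have hbot := Ideal.finset_sup_span_singleton_pow_eq_bot Finset.univ
    (fun k => MonoidAlgebra.of F P (x k) - 1) (fun k => p ^ a k - 1) fun k _ => hnil k
  have hJ : Ideal.jacobson (⊥ : Ideal (MonoidAlgebra F P)) ≤
      Finset.univ.sup fun k => Ideal.span {MonoidAlgebra.of F P (x k) - 1} := by
    refine MonoidAlgebra.jacobson_bot_le_of_closure_eq_top hx ?_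
    rintro _ ⟨k, rfl⟩
    exact Finset.le_sup (f := fun k => Ideal.span {MonoidAlgebra.of F P (x k) - 1})
      (Finset.mem_univ k) (Ideal.mem_span_singleton_self _)
  exact eq_bot_iff.mpr <| (Ideal.pow_right_mono hJ _).trans <|
    (Ideal.pow_le_pow_right (by omega)).trans hbot.le
end
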